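/- Let G be a finite connected simple graph with at least one edge and let n ≥ 2. The ideal I(G)^n is bridge-friendly if and only if either G is a single edge (K_2), or G is a path of length 2 (the path P_3 on 3 vertices), or n ∈ {2,3} and G is the triangle C_3. -/

import Mathlib

open scoped Classical

noncomputable section

namespace ChauHaMaithani

variable {V : Type*}

/-- The lcm of a finite set of monomials (exponent vectors): pointwise maximum. -/
def mlcm (σ : Finset (V → ℕ)) : V → ℕ := fun v => σ.sup fun g => g v

/-- `m` is a bridge of `σ`: `m ∈ σ` and dropping `m` does not change the lcm. -/
def IsBridge (σ : Finset (V → ℕ)) (m : V → ℕ) : Prop :=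
  m ∈ σ ∧ mlcm (σ.erase m) = mlcm σ

/-- `m` is a gap of `σ`: `m ∉ σ` and adding `m` does not change the lcm. -/
def IsGap (σ : Finset (V → ℕ)) (m : V → ℕ) : Prop :=
  m ∉ σ ∧ mlcm (insert m σ) = mlcm σ

/-- A total order `≻` on monomials is encoded by a ranking function `ord`:
`m ≻ m'` iff `ord m' < ord m` (injectivity on the generating set is assumed separately).
`m` is a true gap of `σ` if it is a gap and every bridge of `σ ∪ {m}` dominated by `m`
is already a bridge of `σ`. -/
def IsTrueGap (ord : (V → ℕ) → ℕ) (σ : Finset (V → ℕ)) (m : V → ℕ) : Prop :=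
  IsGap σ m ∧ ∀ m', IsBridge (insert m σ) m' → ord m' < ord m → IsBridge σ m'

/-- `σ` is type-1: it has a true gap (in `M`) dominating none of its bridges. -/
def Type1 (M : Finset (V → ℕ)) (ord : (V → ℕ) → ℕ) (σ : Finset (V → ℕ)) : Prop :=
  ∃ m ∈ M, IsTrueGap ord σ m ∧ ∀ b, IsBridge σ b → ¬ ord b < ord m

/-- `σ` is potentially-type-2: it has a bridge dominating none of its true gaps. -/
def PotType2 (M : Finset (V → ℕ)) (ord : (V → ℕ) → ℕ) (σ : Finset (V → ℕ)) : Prop :=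
  ∃ b, IsBridge σ b ∧ ∀ m ∈ M, IsTrueGap ord σ m → ¬ ord m < ord b

/-- `b` is the `≻`-smallest bridge of `σ`. -/
def IsSBridge (ord : (V → ℕ) → ℕ) (σ : Finset (V → ℕ)) (b : V → ℕ) : Prop :=
  IsBridge σ b ∧ ∀ b', IsBridge σ b' → ord b ≤ ord b'

/-- `σ` is type-2. -/
def Type2 (M : Finset (V → ℕ)) (ord : (V → ℕ) → ℕ) (σ : Finset (V → ℕ)) : Prop :=
  PotType2 M ord σ ∧
    ∀ σ' : Finset (V → ℕ), σ' ⊆ M → σ' ≠ σ → PotType2 M ord σ' →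
      ∀ b b', IsSBridge ord σ b → IsSBridge ord σ' b' →
        σ'.erase b' = σ.erase b → ord b < ord b'

/-- `M` (the minimal generating set of a monomial ideal) is bridge-friendly w.r.t. `ord`:
every potentially-type-2 subset is type-2. -/
def BridgeFriendlyWrt (M : Finset (V → ℕ)) (ord : (V → ℕ) → ℕ) : Prop :=
  ∀ σ ⊆ M, PotType2 M ord σ → Type2 M ord σ

/-- `M` is bridge-friendly: bridge-friendly w.r.t. some total order on `M`. -/
def BridgeFriendly (M : Finset (V → ℕ)) : Prop :=
  ∃ ord : (V → ℕ) → ℕ, Set.InjOn ord M ∧ BridgeFriendlyWrt M ord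

/-- `σ = {m_1 ≻ ⋯ ≻ m_k} ⊆ M` is Lyubeznik-critical w.r.t. `ord`: there is no `m ∈ M` with
`m_t ≻ m` and `m ∣ lcm(m_1, …, m_t)` for some `1 < t ≤ k`. -/
def LyubCritical (M : Finset (V → ℕ)) (ord : (V → ℕ) → ℕ) (σ : Finset (V → ℕ)) : Prop :=
  σ ⊆ M ∧ ¬ ∃ m ∈ M, ∃ t ∈ σ, (∃ u ∈ σ, ord t < ord u) ∧ ord m < ord t ∧
      ∀ v, m v ≤ mlcm (σ.filter fun g => ord t ≤ ord g) v

/-- `M` is Lyubeznik: for some total order on `M`, no Lyubeznik-critical subset has a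
bridge (equivalently, the associated Lyubeznik resolution is minimal). -/
def IsLyubeznik (M : Finset (V → ℕ)) : Prop :=
  ∃ ord : (V → ℕ) → ℕ, Set.InjOn ord M ∧
    ∀ σ : Finset (V → ℕ), LyubCritical M ord σ → ∀ b, ¬ IsBridge σ b

/-- The quadratic monomial `xy` attached to an edge `e = {x,y}`. -/
def edgeMon (e : Sym2 V) : V → ℕ := fun v => if v ∈ e then 1 else 0

/-- `mingens(I(G))`: the edge monomials of `G`. -/
def edgeGens [Fintype V] (G : SimpleGraph V) : Finset (V → ℕ) :=
  (Finset.univ.filter fun e : Sym2 V => e ∈ G.edgeSet).image edgeMon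

/-- `mingens(I(G)^n)`: the monomials that are products of `n` edges of `G`. -/
def edgePowGens [Fintype V] (G : SimpleGraph V) (n : ℕ) : Finset (V → ℕ) :=
  (Finset.univ.filter fun f : Fin n → Sym2 V => ∀ i, f i ∈ G.edgeSet).image
    fun f => ∑ i, edgeMon (f i)

/-- A graph is chordal if it contains no induced cycle of length at least 4. -/
def Chordal (G : SimpleGraph V) : Prop :=
  ∀ n, 4 ≤ n → IsEmpty (SimpleGraph.cycleGraph n ↪g G)


/-- Vertex type of the graph `L(a,b,c)`: `Sum.inl 0` is `x`, `Sum.inl 1` is `y`,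
and the remaining summands are the leaves `x_i`, the leaves `y_j`, and the
triangle tips `z_k`. -/
abbrev LV (a b c : ℕ) := Fin 2 ⊕ (Fin a ⊕ Fin b ⊕ Fin c)

/-- The graph `L(a,b,c)`: `c` triangles glued along the common edge `{x,y}`, with
`a` leaves attached to `x` and `b` leaves attached to `y`. -/
def LGraph (a b c : ℕ) : SimpleGraph (LV a b c) :=
  SimpleGraph.fromRel fun u v =>
    (u = Sum.inl 0 ∧ v = Sum.inl 1) ∨
    (∃ i, u = Sum.inl 0 ∧ v = Sum.inr (Sum.inl i)) ∨
    (∃ j, u = Sum.inl 1 ∧ v = Sum.inr (Sum.inr (Sum.inl j))) ∨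
    (∃ k, (u = Sum.inl 0 ∨ u = Sum.inl 1) ∧ v = Sum.inr (Sum.inr (Sum.inr k)))

/-- The graph `BF(T,w)`: attach `w(e)` new triangles along each edge `e` of `T`. -/
def BFGraph {VT : Type} (T : SimpleGraph VT) (w : T.edgeSet → ℕ) :
    SimpleGraph (VT ⊕ (Σ e : T.edgeSet, Fin (w e))) :=
  SimpleGraph.fromRel fun u v =>
    (∃ a b, u = Sum.inl a ∧ v = Sum.inl b ∧ T.Adj a b) ∨
    (∃ (a : VT) (e : T.edgeSet) (i : Fin (w e)), u = Sum.inl a ∧ v = Sum.inr ⟨e, i⟩ ∧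
      a ∈ (e : Sym2 VT))

/-- The kite graph: the diamond (`K₄` minus the edge `{2,3}`) together with a pendant
vertex `4` attached to the degree-two vertex `2`. -/
def kite : SimpleGraph (Fin 5) :=
  SimpleGraph.fromEdgeSet {s(0,1), s(0,2), s(0,3), s(1,2), s(1,3), s(2,4)}

/-- The gem graph: the path `0-1-2-3` together with a vertex `4` adjacent to all of
`0,1,2,3`. -/
def gem : SimpleGraph (Fin 5) :=
  SimpleGraph.fromEdgeSet {s(0,1), s(1,2), s(2,3), s(0,4), s(1,4), s(2,4), s(3,4)}

/-- The tadpole graph: the triangle `0,1,2` with a path `0-3-4` of length 2 attached. -/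
def tadpole : SimpleGraph (Fin 5) :=
  SimpleGraph.fromEdgeSet {s(0,1), s(1,2), s(0,2), s(0,3), s(3,4)}

/-- The butterfly graph: two triangles `0,1,2` and `0,3,4` sharing the vertex `0`. -/
def butterfly : SimpleGraph (Fin 5) :=
  SimpleGraph.fromEdgeSet {s(0,1), s(1,2), s(0,2), s(0,3), s(3,4), s(0,4)}

/-- The net graph: the triangle `0,1,2` with pendant vertices `3,4,5` attached to
`0,1,2` respectively. -/
def net : SimpleGraph (Fin 6) :=
  SimpleGraph.fromEdgeSet {s(0,1), s(1,2), s(0,2), s(0,3), s(1,4), s(2,5)}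

section General

theorem le_mlcm_iff {σ : Finset (V → ℕ)} {m : V → ℕ} :
    m ≤ mlcm σ ↔ ∀ v, m v = 0 ∨ ∃ g ∈ σ, m v ≤ g v := by
  refine forall_congr' fun v => ?_
  rcases Nat.eq_zero_or_pos (m v) with h | h
  · simp [h]
  · rw [mlcm, Finset.le_sup_iff (by simpa using h)]
    simp [h.ne']

theorem mlcm_mono {σ τ : Finset (V → ℕ)} (h : σ ⊆ τ) : mlcm σ ≤ mlcm τ :=
  fun _ => Finset.sup_mono h

theorem mlcm_insert (σ : Finset (V → ℕ)) (m : V → ℕ) :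
    mlcm (insert m σ) = m ⊔ mlcm σ := by
  funext v
  simp [mlcm]

theorem isGap_iff {σ : Finset (V → ℕ)} {m : V → ℕ} :
    IsGap σ m ↔ m ∉ σ ∧ m ≤ mlcm σ := by
  rw [IsGap, mlcm_insert, sup_eq_right]

theorem isBridge_iff {σ : Finset (V → ℕ)} {m : V → ℕ} :
    IsBridge σ m ↔ m ∈ σ ∧ m ≤ mlcm (σ.erase m) := by
  refine and_congr_right fun hm => ?_
  have h := mlcm_insert (σ.erase m) m
  rw [Finset.insert_erase hm] at h
  rw [h, eq_comm, sup_eq_right]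

/-- `q` is the smallest bridge of the potentially-type-2 set `insert q τ`, spelled out in terms
of divisibility into lcms. -/
def IsPivot (M : Finset (V → ℕ)) (ord : (V → ℕ) → ℕ) (τ : Finset (V → ℕ)) (q : V → ℕ) : Prop :=
  q ≤ mlcm τ ∧ (∀ b ∈ τ, b ≤ mlcm ((insert q τ).erase b) → ord q < ord b) ∧
    ∀ g ∈ M, g ∉ insert q τ → g ≤ mlcm τ → ord q < ord g ∨
      ∃ m ∈ insert q τ, ord m < ord g ∧ m ≤ mlcm (insert g ((insert q τ).erase m)) ∧
        ¬ m ≤ mlcm ((insert q τ).erase m)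

theorem isPivot_iff {M : Finset (V → ℕ)} {ord : (V → ℕ) → ℕ} (hord : Set.InjOn ord M)
    {τ : Finset (V → ℕ)} (hτ : τ ⊆ M) {q : V → ℕ} (hq : q ∈ M) (hqτ : q ∉ τ) :
    IsPivot M ord τ q ↔ IsSBridge ord (insert q τ) q ∧ PotType2 M ord (insert q τ) := by
  have herase : (insert q τ).erase q = τ := Finset.erase_insert hqτ
  have hsub : insert q τ ⊆ M := Finset.insert_subset hq hτ
  have hbr : IsBridge (insert q τ) q ↔ q ≤ mlcm τ := by
    rw [isBridge_iff, herase]; simp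
  have hsb : IsSBridge ord (insert q τ) q ↔
      q ≤ mlcm τ ∧ ∀ b ∈ τ, b ≤ mlcm ((insert q τ).erase b) → ord q < ord b := by
    rw [IsSBridge, hbr]
    refine and_congr_right fun hqle => ⟨fun h b hb hb' => ?_, fun h b hb => ?_⟩
    · refine lt_of_le_of_ne (h b (isBridge_iff.2 ⟨Finset.mem_insert_of_mem hb, hb'⟩)) fun he => ?_
      exact hqτ (hord hq (hτ hb) he ▸ hb)
    · rw [isBridge_iff, Finset.mem_insert] at hb
      rcases hb with ⟨rfl | hb, hb'⟩
      · exact le_rfl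
      · exact (h b hb hb').le
  rw [IsPivot, ← and_assoc, ← hsb]
  refine and_congr_right fun hs => ?_
  have hqle : q ≤ mlcm τ := (hsb.1 hs).1
  have hlcm : mlcm (insert q τ) = mlcm τ := by rw [mlcm_insert, sup_eq_right.2 hqle]
  have hpot : PotType2 M ord (insert q τ) ↔
      ∀ g ∈ M, IsTrueGap ord (insert q τ) g → ord q < ord g := by
    constructor
    · rintro ⟨b, hb, h⟩ g hg hgap
      refine lt_of_le_of_ne ((hs.2 b hb).trans (not_lt.1 (h g hg hgap))) fun he => ?_
      exact (isGap_iff.1 hgap.1).1 (hord hq hg he ▸ Finset.mem_insert_self q τ)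
    · exact fun h => ⟨q, hs.1, fun g hg hgap => (h g hg hgap).le.not_gt⟩
  rw [hpot]
  refine forall₂_congr fun g hg => ?_
  rw [IsTrueGap, isGap_iff, hlcm]
  have hkey : g ∉ insert q τ → ((∃ m ∈ insert q τ, ord m < ord g ∧
      m ≤ mlcm (insert g ((insert q τ).erase m)) ∧ ¬ m ≤ mlcm ((insert q τ).erase m)) ↔
      ¬ ∀ m', IsBridge (insert g (insert q τ)) m' → ord m' < ord g →
        IsBridge (insert q τ) m') := by
    intro hgσ
    push Not
    refine exists_congr fun m => ?_
    rw [isBridge_iff, isBridge_iff]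
    by_cases hm : m = g
    · subst hm; simp [hgσ]
    · rw [Finset.erase_insert_of_ne (Ne.symm hm)]
      simp only [Finset.mem_insert, hm, false_or]
      tauto
  by_cases hgσ : g ∉ insert q τ
  · rw [hkey hgσ]
    by_cases hd : ord q < ord g <;> simp [hd, hgσ]
  · exact ⟨fun _ h => (hgσ h.1.1).elim, fun _ h => (hgσ h).elim⟩

/-- Bridge-friendliness says that a set has at most one pivot. -/
theorem bridgeFriendlyWrt_iff {M : Finset (V → ℕ)} {ord : (V → ℕ) → ℕ}
    (hord : Set.InjOn ord M) :
    BridgeFriendlyWrt M ord ↔ ∀ τ ⊆ M, ∀ q ∈ M, ∀ r ∈ M, q ∉ τ → r ∉ τ →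
      IsPivot M ord τ q → IsPivot M ord τ r → q = r := by
  constructor
  · intro h τ hτ q hq r hr hqτ hrτ hpq hpr
    rw [isPivot_iff hord hτ hq hqτ] at hpq
    rw [isPivot_iff hord hτ hr hrτ] at hpr
    by_contra hne
    have hσ : insert q τ ≠ insert r τ := fun he => by
      have : q ∈ insert r τ := he ▸ Finset.mem_insert_self q τ
      simp [hne, hqτ] at this
    have e : (insert q τ).erase q = (insert r τ).erase r := by
      rw [Finset.erase_insert hqτ, Finset.erase_insert hrτ]
    have h1 := (h _ (Finset.insert_subset hq hτ) hpq.2).2 _ (Finset.insert_subset hr hτ)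
      hσ.symm hpr.2 q r hpq.1 hpr.1 e.symm
    have h2 := (h _ (Finset.insert_subset hr hτ) hpr.2).2 _ (Finset.insert_subset hq hτ)
      hσ hpq.2 r q hpr.1 hpq.1 e
    omega
  · intro h σ hσ hpot
    refine ⟨hpot, fun σ' hσ' hne hpot' b b' hb hb' he => (hne ?_).elim⟩
    have hbσ : b ∈ σ := hb.1.1
    have hbσ' : b' ∈ σ' := hb'.1.1
    have hτ : σ.erase b ⊆ M := (Finset.erase_subset _ _).trans hσ
    have h1 : IsPivot M ord (σ.erase b) b := by
      rw [isPivot_iff hord hτ (hσ hbσ) (Finset.notMem_erase _ _), Finset.insert_erase hbσ]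
      exact ⟨hb, hpot⟩
    have h2 : IsPivot M ord (σ.erase b) b' := by
      rw [isPivot_iff hord hτ (hσ' hbσ') (he ▸ Finset.notMem_erase _ _), ← he,
        Finset.insert_erase hbσ']
      exact ⟨hb', hpot'⟩
    have := h _ hτ b (hσ hbσ) b' (hσ' hbσ') (Finset.notMem_erase _ _)
      (he ▸ Finset.notMem_erase _ _) h1 h2
    rw [← Finset.insert_erase hbσ, ← Finset.insert_erase hbσ', he, this]

end General

section Reflection

/-- Exponent vectors in four variables. -/
abbrev Quad := ℕ × ℕ × ℕ × ℕ

/-- `x` divides the lcm of the (nonempty) list `S`. -/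
def covers (S : List Quad) (x : Quad) : Bool :=
  S.any (fun y => Nat.ble x.1 y.1) && S.any (fun y => Nat.ble x.2.1 y.2.1) &&
    S.any (fun y => Nat.ble x.2.2.1 y.2.2.1) && S.any (fun y => Nat.ble x.2.2.2 y.2.2.2)

/-- The list `S` with all copies of `x` removed. -/
def without (S : List Quad) (x : Quad) : List Quad := S.filter fun y => y != x

/-- `IsPivot` for lists, where `lt a b` is known to imply that `a` precedes `b`. -/
def pivotB (L : List Quad) (lt : Quad → Quad → Bool) (τ : List Quad) (q : Quad) : Bool :=
  covers τ q && τ.all (fun b => !covers (without (q :: τ) b) b || lt q b) &&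
    L.all fun g => (q :: τ).contains g || !covers τ g || lt q g ||
      (q :: τ).any fun m => lt m g && covers (g :: without (q :: τ) m) m &&
        !covers (without (q :: τ) m) m

/-- Every subset of the list `L`, ordered by `o`, has at most one pivot. -/
def Friendly (L : List Quad) (o : Quad → ℕ) : Prop :=
  ∀ τ ⊆ L, ∀ q ∈ L, ∀ r ∈ L, q ∉ τ → r ∉ τ → pivotB L (fun a b => o a < o b) τ q →
    pivotB L (fun a b => o a < o b) τ r → q = r

/-- Some element of `A` precedes `b` in every order whose smallest elements are `pre`, listed
increasingly. -/
def precedes : List Quad → List Quad → Quad → Bool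
  | [], _, _ => false
  | p :: pre, A, b => !(p == b) && (A.contains p || precedes pre A b)

/-- The list `pre` consists of the smallest elements of `L`, in increasing order. -/
def IsInitial (L : List Quad) (o : Quad → ℕ) : List Quad → Prop
  | [] => True
  | p :: pre => p ∈ L ∧ (∀ x ∈ L, x ≠ p → o p < o x) ∧ IsInitial (without L p) o pre

theorem mem_without {S : List Quad} {x y : Quad} : y ∈ without S x ↔ y ∈ S ∧ y ≠ x := by
  simp [without]

theorem IsInitial.exists_lt {L : List Quad} {o : Quad → ℕ} {pre : List Quad}
    (h : IsInitial L o pre) {A : List Quad} {b : Quad} (hb : b ∈ L) (hA : precedes pre A b) :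
    ∃ a ∈ A, o a < o b := by
  induction pre generalizing L with
  | nil => simp [precedes] at hA
  | cons p pre ih =>
    simp only [precedes, Bool.and_eq_true, Bool.not_eq_true', beq_eq_false_iff_ne,
      Bool.or_eq_true, List.contains_iff_mem] at hA
    rcases hA.2 with hp | hp
    · exact ⟨p, hp, h.2.1 b hb (Ne.symm hA.1)⟩
    · exact ih h.2.2 (mem_without.2 ⟨hb, Ne.symm hA.1⟩) hp

theorem IsInitial.exists_append {L : List Quad} {o : Quad → ℕ} (ho : Set.InjOn o {x | x ∈ L})
    {pre : List Quad} (h : IsInitial L o pre) {y : Quad} (hy : y ∈ L) (hypre : y ∉ pre) :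
    ∃ s ∈ L, s ∉ pre ∧ IsInitial L o (pre ++ [s]) := by
  induction pre generalizing L with
  | nil =>
    obtain ⟨s, hs, hmin⟩ := L.toFinset.exists_min_image o ⟨y, by simpa using hy⟩
    simp only [List.mem_toFinset] at hs hmin
    exact ⟨s, hs, by simp, hs, fun x hx hne =>
      lt_of_le_of_ne (hmin x hx) fun he => hne (ho hx hs he.symm), trivial⟩
  | cons p pre ih =>
    simp only [List.mem_cons, not_or] at hypre
    obtain ⟨s, hs, hspre, hinit⟩ := ih (L := without L p)
      (ho.mono fun x hx => (mem_without.1 hx).1) h.2.2 (mem_without.2 ⟨hy, hypre.1⟩) hypre.2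
    rw [mem_without] at hs
    exact ⟨s, hs.1, by simp [hs.2, hspre], h.1, h.2.1, hinit⟩

/-- A list of candidates `(τ, q, r)` for a set `τ` with two distinct pivots `q`, `r`. -/
abbrev Rules := List (List Quad × Quad × Quad)

/-- Conditions ensuring that `q` is a pivot of `τ`: for each member `(A, g)` of the list, some
element of `A` has to precede `g`. -/
def pivotConds (L τ : List Quad) (q : Quad) : List (List Quad × Quad) :=
  (if covers τ q then [] else [([], q)]) ++
    (τ.filter fun b => covers (without (q :: τ) b) b).map (fun b => ([q], b)) ++
    (L.filter fun g => !(q :: τ).contains g && covers τ g).map fun g =>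
      (q :: (q :: τ).filter fun m => covers (g :: without (q :: τ) m) m &&
        !covers (without (q :: τ) m) m, g)

theorem pivotB_of_pivotConds {L τ : List Quad} {q : Quad} {lt : Quad → Quad → Bool}
    (h : ∀ c ∈ pivotConds L τ q, ∃ a ∈ c.1, lt a c.2) : pivotB L lt τ q := by
  simp only [pivotConds, List.mem_append, List.mem_map, List.mem_filter] at h
  simp only [pivotB, Bool.and_eq_true, Bool.or_eq_true, List.all_eq_true, List.any_eq_true]
  refine ⟨⟨?_, fun b hb => ?_⟩, fun g hg => ?_⟩
  · by_contra hq
    obtain ⟨a, ha, -⟩ := h ([], q) (Or.inl (Or.inl (by simp [hq])))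
    simp at ha
  · by_cases hc : covers (without (q :: τ) b) b
    · obtain ⟨a, ha, hlt⟩ := h ([q], b) (Or.inl (Or.inr ⟨b, ⟨hb, hc⟩, rfl⟩))
      exact Or.inr (List.mem_singleton.1 ha ▸ hlt)
    · simp [hc]
  · by_cases hmem : (q :: τ).contains g
    · exact Or.inl (Or.inl (Or.inl hmem))
    by_cases hc : covers τ g
    · obtain ⟨a, ha, hlt⟩ := h _ (Or.inr ⟨g, ⟨hg, by rw [hc, Bool.eq_false_iff.2 hmem]; rfl⟩, rfl⟩)
      rcases List.mem_cons.1 ha with rfl | ha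
      · exact Or.inl (Or.inr hlt)
      · rw [List.mem_filter, Bool.and_eq_true] at ha
        exact Or.inr ⟨a, ha.1, ⟨hlt, ha.2.1⟩, ha.2.2⟩
    · simp [hc]

theorem mem_of_mem_pivotConds {L τ : List Quad} {q : Quad} (hτ : τ ⊆ L) (hq : q ∈ L)
    {c : List Quad × Quad} (hc : c ∈ pivotConds L τ q) : c.2 ∈ L := by
  simp only [pivotConds, List.mem_append, List.mem_map, List.mem_filter] at hc
  rcases hc with (hc | ⟨b, hb, rfl⟩) | ⟨g, hg, rfl⟩
  · split_ifs at hc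
    · simp at hc
    · exact List.mem_singleton.1 hc ▸ hq
  · exact hτ hb.1
  · exact hg.1

/-- The conditions under which a rule yields two pivots. -/
def ruleConds (L : List Quad) (R : Rules) : List (List (List Quad × Quad)) :=
  R.map fun ρ => pivotConds L ρ.1 ρ.2.1 ++ pivotConds L ρ.1 ρ.2.2

/-- Search tree over the initial segments `pre` of the order on `L`: it is `true` if on every
branch the conditions of some rule hold. -/
def refutes (L : List Quad) (C : List (List (List Quad × Quad))) : ℕ → List Quad → Bool
  | 0, _ => false
  | k + 1, pre =>
    (C.any fun ρ => ρ.all fun c => precedes pre c.1 c.2) ||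
      (L.any (fun s => !pre.contains s) &&
        L.all fun s => pre.contains s || refutes L C k (pre ++ [s]))

/-- The rules involve only elements of `L`, and are non-degenerate. -/
def validRules (L : List Quad) (R : Rules) : Bool :=
  R.all fun ρ => ρ.1.all (fun x => L.contains x) && L.contains ρ.2.1 && L.contains ρ.2.2 &&
    !ρ.1.contains ρ.2.1 && !ρ.1.contains ρ.2.2 && !(ρ.2.1 == ρ.2.2)

theorem Friendly.refutes_eq_false {L : List Quad} {o : Quad → ℕ} (h : Friendly L o)
    (ho : Set.InjOn o {x | x ∈ L}) {R : Rules} (hR : validRules L R) {k : ℕ} {pre : List Quad}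
    (hpre : IsInitial L o pre) : refutes L (ruleConds L R) k pre = false := by
  induction k generalizing pre with
  | zero => rfl
  | succ k ih =>
    rw [← Bool.not_eq_true]
    intro hcon
    simp only [refutes, Bool.or_eq_true, Bool.and_eq_true, List.any_eq_true, List.all_eq_true,
      Bool.not_eq_true', List.contains_iff_mem] at hcon
    rcases hcon with ⟨c, hc, hall⟩ | ⟨⟨y, hy, hypre⟩, hall⟩
    · obtain ⟨ρ, hρ, rfl⟩ := List.mem_map.1 hc
      simp only [validRules, List.all_eq_true, Bool.and_eq_true, Bool.not_eq_true',
        List.contains_iff_mem, beq_eq_false_iff_ne] at hR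
      obtain ⟨⟨⟨⟨⟨hτ, hq⟩, hr⟩, hqτ⟩, hrτ⟩, hne⟩ := hR ρ hρ
      refine hne (h _ hτ _ hq _ hr (by simpa using hqτ) (by simpa using hrτ)
        (pivotB_of_pivotConds fun c hc => ?_) (pivotB_of_pivotConds fun c hc => ?_))
      · simpa using hpre.exists_lt (mem_of_mem_pivotConds hτ hq hc)
          (hall c (List.mem_append_left _ hc))
      · simpa using hpre.exists_lt (mem_of_mem_pivotConds hτ hr hc)
          (hall c (List.mem_append_right _ hc))
    · obtain ⟨s, hs, hspre, hinit⟩ := hpre.exists_append ho hy (by simpa using hypre)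
      have := (hall s hs).resolve_left hspre
      simp [ih hinit] at this

/-- If every order on `L` not starting with `s` is refuted, then `s` is the smallest element. -/
theorem Friendly.le_of_refutes {L : List Quad} {o : Quad → ℕ} (h : Friendly L o)
    (ho : Set.InjOn o {x | x ∈ L}) {R : Rules} (hR : validRules L R) {k : ℕ} {s : Quad}
    (hs : L.all fun t => t == s || refutes L (ruleConds L R) k [t]) {x : Quad} (hx : x ∈ L) :
    o s ≤ o x := by
  obtain ⟨t, ht, -, hinit⟩ := IsInitial.exists_append ho (pre := []) trivial hx (by simp)
  have := List.all_eq_true.1 hs t ht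
  rw [h.refutes_eq_false (pre := [t]) ho hR hinit, Bool.or_false, beq_iff_eq] at this
  by_cases hxt : x = t
  · rw [hxt, this]
  · exact this ▸ (hinit.2.1 x hx hxt).le

/-- A set with two pivots refutes some of the inequalities that make them pivots. -/
theorem Friendly.exists_le {L : List Quad} {o : Quad → ℕ} (h : Friendly L o)
    (K : List (Quad × Quad)) {τ : List Quad} {q r : Quad} (hR : validRules L [(τ, q, r)])
    (hK : (ruleConds L [(τ, q, r)]).all fun ρ => ρ.all fun c => c.1.any fun a =>
      K.contains (a, c.2)) : ∃ p ∈ K, o p.2 ≤ o p.1 := by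
  by_contra! hlt
  simp only [validRules, List.all_cons, List.all_nil, List.all_eq_true, Bool.and_eq_true,
    Bool.not_eq_true', List.contains_iff_mem, beq_eq_false_iff_ne] at hR
  obtain ⟨⟨⟨⟨⟨⟨hτ, hq⟩, hr⟩, hqτ⟩, hrτ⟩, hne⟩, -⟩ := hR
  simp only [ruleConds, List.map_cons, List.map_nil, List.all_cons, List.all_nil, Bool.and_true,
    List.all_eq_true, List.any_eq_true, List.contains_iff_mem] at hK
  refine hne (h _ hτ _ hq _ hr (by simpa using hqτ) (by simpa using hrτ)
    (pivotB_of_pivotConds fun c hc => ?_) (pivotB_of_pivotConds fun c hc => ?_))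
  · obtain ⟨a, ha, hac⟩ := hK c (List.mem_append_left _ hc)
    exact ⟨a, ha, by simpa using hlt _ hac⟩
  · obtain ⟨a, ha, hac⟩ := hK c (List.mem_append_right _ hc)
    exact ⟨a, ha, by simpa using hlt _ hac⟩

end Reflection

section Transport

/-- The set of monomials encoded by the list `S`. -/
def encoded (φ : Quad → V → ℕ) (S : List Quad) : Finset (V → ℕ) := (S.map φ).toFinset

theorem mem_encoded {φ : Quad → V → ℕ} {S : List Quad} {m : V → ℕ} :
    m ∈ encoded φ S ↔ ∃ x ∈ S, φ x = m := by
  simp [encoded]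

/-- The list `L` encodes, via `φ`, all elements of `M` dividing the lcm of `L`. -/
structure Encodes (φ : Quad → V → ℕ) (L : List Quad) (M : Finset (V → ℕ)) : Prop where
  mem : ∀ x ∈ L, φ x ∈ M
  inj : Set.InjOn φ {x | x ∈ L}
  exists_eq : ∀ m ∈ M, m ≤ mlcm (encoded φ L) → ∃ x ∈ L, φ x = m
  covers_iff : ∀ S ⊆ L, ∀ x ∈ L, covers S x ↔ φ x ≤ mlcm (encoded φ S)

variable {φ : Quad → V → ℕ} {L : List Quad} {M : Finset (V → ℕ)}

theorem encoded_cons (S : List Quad) (x : Quad) :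
    encoded φ (x :: S) = insert (φ x) (encoded φ S) := by
  simp [encoded]

theorem encoded_without (hinj : Set.InjOn φ {x | x ∈ L}) {S : List Quad} (hS : S ⊆ L)
    {x : Quad} (hx : x ∈ L) : encoded φ (without S x) = (encoded φ S).erase (φ x) := by
  ext m
  simp only [mem_encoded, mem_without, Finset.mem_erase]
  constructor
  · rintro ⟨y, ⟨hy, hne⟩, rfl⟩
    exact ⟨fun he => hne (hinj (hS hy) hx he), y, hy, rfl⟩
  · rintro ⟨hne, y, hy, rfl⟩
    exact ⟨y, ⟨hy, fun he => hne (he ▸ rfl)⟩, rfl⟩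

theorem Encodes.mem_encoded_iff (h : Encodes φ L M) {S : List Quad} (hS : S ⊆ L)
    {x : Quad} (hx : x ∈ L) : φ x ∈ encoded φ S ↔ x ∈ S := by
  rw [mem_encoded]
  exact ⟨fun ⟨y, hy, he⟩ => h.inj (hS hy) hx he ▸ hy, fun hx => ⟨x, hx, rfl⟩⟩

theorem encoded_mono {S S' : List Quad} (h : S ⊆ S') : encoded φ S ⊆ encoded φ S' := by
  intro m
  simp only [mem_encoded]
  exact fun ⟨x, hx, he⟩ => ⟨x, h hx, he⟩

theorem Encodes.isPivot_iff (h : Encodes φ L M) (ord : (V → ℕ) → ℕ) {τ : List Quad}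
    (hτ : τ ⊆ L) {q : Quad} (hq : q ∈ L) :
    IsPivot M ord (encoded φ τ) (φ q) ↔
      pivotB L (fun a b => ord (φ a) < ord (φ b)) τ q := by
  have hsub : q :: τ ⊆ L := List.cons_subset.2 ⟨hq, hτ⟩
  have hw : ∀ x, without (q :: τ) x ⊆ L := fun x y hy => hsub (mem_without.1 hy).1
  have herase : ∀ x ∈ L, (insert (φ q) (encoded φ τ)).erase (φ x) =
      encoded φ (without (q :: τ) x) := fun x hx => by
    rw [encoded_without h.inj hsub hx, encoded_cons]
  simp only [IsPivot, pivotB, Bool.and_eq_true, Bool.or_eq_true, List.all_eq_true,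
    List.any_eq_true, Bool.not_eq_true', decide_eq_true_eq, List.contains_iff_mem, ← and_assoc]
  refine and_congr (and_congr (h.covers_iff τ hτ q hq).symm ?_) ?_
  · constructor
    · intro h' b hb
      rw [← Bool.not_eq_true, h.covers_iff _ (hw b) b (hτ hb), ← herase b (hτ hb)]
      have := h' (φ b) (mem_encoded.2 ⟨b, hb, rfl⟩)
      tauto
    · intro h' m hm hle
      obtain ⟨b, hb, rfl⟩ := mem_encoded.1 hm
      have := h' b hb
      rw [← Bool.not_eq_true, h.covers_iff _ (hw b) b (hτ hb), ← herase b (hτ hb)] at this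
      tauto
  · have hany : ∀ g ∈ L, ((∃ m ∈ insert (φ q) (encoded φ τ), (ord m < ord (φ g) ∧
        m ≤ mlcm (insert (φ g) ((insert (φ q) (encoded φ τ)).erase m))) ∧
        ¬ m ≤ mlcm ((insert (φ q) (encoded φ τ)).erase m)) ↔
        ∃ x ∈ q :: τ, (ord (φ x) < ord (φ g) ∧ covers (g :: without (q :: τ) x) x = true) ∧
          covers (without (q :: τ) x) x = false) := by
      intro g hg
      rw [← encoded_cons]
      have hx : ∀ x ∈ q :: τ, (ord (φ x) < ord (φ g) ∧
          covers (g :: without (q :: τ) x) x = true) ∧ covers (without (q :: τ) x) x = false ↔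
          (ord (φ x) < ord (φ g) ∧ φ x ≤ mlcm (insert (φ g) ((encoded φ (q :: τ)).erase (φ x)))) ∧
          ¬ φ x ≤ mlcm ((encoded φ (q :: τ)).erase (φ x)) := by
        intro x hx
        rw [← Bool.not_eq_true, h.covers_iff _ (hw x) x (hsub hx),
          h.covers_iff _ (List.cons_subset.2 ⟨hg, hw x⟩) x (hsub hx), encoded_cons,
          encoded_cons, ← herase x (hsub hx)]
      constructor
      · rintro ⟨m, hm, hm'⟩
        obtain ⟨x, hxm, rfl⟩ := mem_encoded.1 hm
        exact ⟨x, hxm, (hx x hxm).2 hm'⟩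
      · rintro ⟨x, hxm, hx'⟩
        exact ⟨φ x, mem_encoded.2 ⟨x, hxm, rfl⟩, (hx x hxm).1 hx'⟩
    simp only [← and_assoc] at hany
    constructor
    · intro h' g hg
      have := h' (φ g) (h.mem g hg)
      rw [hany g hg, ← encoded_cons, h.mem_encoded_iff hsub hg, ← h.covers_iff τ hτ g hg] at this
      rw [← Bool.not_eq_true]
      tauto
    · intro h' m hm hmem hle
      obtain ⟨g, hg, rfl⟩ := h.exists_eq m hm (hle.trans (mlcm_mono (encoded_mono hτ)))
      have := h' g hg
      rw [hany g hg]
      rw [← encoded_cons, h.mem_encoded_iff hsub hg] at hmem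
      rw [← h.covers_iff τ hτ g hg] at hle
      rw [← Bool.not_eq_true] at this
      tauto

theorem Encodes.friendly (h : Encodes φ L M) {ord : (V → ℕ) → ℕ} (hord : Set.InjOn ord M)
    (hM : BridgeFriendlyWrt M ord) : Friendly L (fun x => ord (φ x)) := by
  intro τ hτ q hq r hr hqτ hrτ h1 h2
  rw [← h.isPivot_iff ord hτ hq] at h1
  rw [← h.isPivot_iff ord hτ hr] at h2
  rw [bridgeFriendlyWrt_iff hord] at hM
  refine h.inj hq hr (hM _ ?_ _ (h.mem q hq) _ (h.mem r hr) ?_ ?_ h1 h2)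
  · intro m hm
    obtain ⟨x, hx, rfl⟩ := mem_encoded.1 hm
    exact h.mem x (hτ hx)
  · rwa [h.mem_encoded_iff hτ hq]
  · rwa [h.mem_encoded_iff hτ hr]

theorem Encodes.injOn (h : Encodes φ L M) {ord : (V → ℕ) → ℕ} (hord : Set.InjOn ord M) :
    Set.InjOn (fun x => ord (φ x)) {x | x ∈ L} :=
  hord.comp h.inj fun x hx => h.mem x hx

end Transport

section Certificates

/-- The four monomials `bc, ab, cd, ad` in the variables `a, b, c, d`. -/
def rhombusList : List Quad :=
  [(0, 1, 1, 0), (1, 1, 0, 0), (0, 0, 1, 1), (1, 0, 0, 1)]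

/-- Candidates for sets with two pivots in `rhombusList`. -/
def rhombusListRules : Rules :=
  [([(0, 1, 1, 0), (1, 0, 0, 1)], (1, 1, 0, 0), (0, 0, 1, 1)),
    ([(1, 1, 0, 0), (0, 0, 1, 1)], (0, 1, 1, 0), (1, 0, 0, 1))]

/-- The elements of the square of the diamond (or paw) ideal dividing `ab²c²d`. -/
def sixList : List Quad :=
  [(0, 1, 2, 1), (0, 2, 1, 1), (0, 2, 2, 0), (1, 1, 1, 1), (1, 2, 0, 1), (1, 2, 1, 0)]

/-- Candidates for sets with two pivots in `sixList`. -/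
def sixListRules : Rules :=
  [([(0, 1, 2, 1), (1, 2, 0, 1)], (0, 2, 1, 1), (1, 1, 1, 1)),
    ([(0, 1, 2, 1), (1, 2, 1, 0)], (0, 2, 1, 1), (0, 2, 2, 0)),
    ([(0, 2, 2, 0), (1, 1, 1, 1)], (0, 1, 2, 1), (0, 2, 1, 1)),
    ([(0, 1, 2, 1), (1, 2, 1, 0)], (0, 2, 2, 0), (1, 1, 1, 1)),
    ([(0, 2, 2, 0), (1, 1, 1, 1)], (0, 1, 2, 1), (1, 2, 1, 0)),
    ([(0, 2, 2, 0), (1, 1, 1, 1)], (0, 2, 1, 1), (1, 2, 1, 0)),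
    ([(0, 1, 2, 1), (1, 2, 0, 1)], (0, 2, 2, 0), (1, 1, 1, 1)),
    ([(0, 1, 2, 1), (1, 2, 1, 0)], (0, 2, 1, 1), (1, 1, 1, 1)),
    ([(0, 2, 2, 0), (1, 1, 1, 1)], (0, 1, 2, 1), (1, 2, 0, 1))]

/-- The elements of the square of the diamond ideal dividing `a²b²cd`. -/
def sixList' : List Quad :=
  [(0, 2, 1, 1), (1, 1, 1, 1), (1, 2, 0, 1), (1, 2, 1, 0), (2, 1, 0, 1), (2, 2, 0, 0)]

/-- Candidates for sets with two pivots in `sixList'`. -/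
def sixList'Rules : Rules :=
  [([(0, 2, 1, 1), (2, 1, 0, 1)], (1, 1, 1, 1), (1, 2, 0, 1)),
    ([(1, 1, 1, 1), (2, 2, 0, 0)], (1, 2, 0, 1), (1, 2, 1, 0)),
    ([(1, 2, 1, 0), (2, 1, 0, 1)], (1, 1, 1, 1), (1, 2, 0, 1)),
    ([(0, 2, 1, 1), (2, 2, 0, 0)], (1, 2, 0, 1), (1, 2, 1, 0)),
    ([(1, 1, 1, 1), (2, 2, 0, 0)], (1, 2, 1, 0), (2, 1, 0, 1)),
    ([(1, 2, 1, 0), (2, 1, 0, 1)], (1, 1, 1, 1), (2, 2, 0, 0)),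
    ([(1, 2, 1, 0), (2, 1, 0, 1)], (1, 2, 0, 1), (2, 2, 0, 0)),
    ([(1, 1, 1, 1), (2, 2, 0, 0)], (1, 2, 0, 1), (2, 1, 0, 1))]

/-- The elements of the cube of the diamond (or paw) ideal dividing `a²b³c²d`. -/
def sevenList : List Quad :=
  [(0, 3, 2, 1), (1, 2, 2, 1), (1, 3, 1, 1), (1, 3, 2, 0), (2, 2, 1, 1), (2, 3, 0, 1),
    (2, 3, 1, 0)]

/-- Candidates for sets with two pivots in `sevenList`. -/
def sevenListRules : Rules :=
  [([(0, 3, 2, 1), (2, 2, 1, 1)], (1, 2, 2, 1), (1, 3, 1, 1)),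
    ([(1, 2, 2, 1), (2, 3, 1, 0)], (1, 3, 1, 1), (1, 3, 2, 0)),
    ([(1, 2, 2, 1), (2, 3, 0, 1)], (1, 3, 1, 1), (2, 2, 1, 1)),
    ([(1, 3, 2, 0), (2, 2, 1, 1)], (1, 2, 2, 1), (1, 3, 1, 1)),
    ([(0, 3, 2, 1), (2, 3, 1, 0)], (1, 3, 1, 1), (1, 3, 2, 0)),
    ([(1, 2, 2, 1), (2, 3, 1, 0)], (1, 3, 2, 0), (2, 2, 1, 1)),
    ([(1, 3, 2, 0), (2, 2, 1, 1)], (1, 2, 2, 1), (2, 3, 1, 0)),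
    ([(0, 3, 2, 1), (2, 2, 1, 1)], (1, 2, 2, 1), (2, 3, 0, 1)),
    ([(1, 3, 2, 0), (2, 2, 1, 1)], (1, 2, 2, 1), (2, 3, 0, 1)),
    ([(1, 3, 2, 0), (2, 2, 1, 1)], (1, 3, 1, 1), (2, 3, 1, 0)),
    ([(1, 2, 2, 1), (2, 3, 0, 1)], (0, 3, 2, 1), (2, 2, 1, 1)),
    ([(1, 2, 2, 1), (2, 3, 0, 1)], (1, 3, 2, 0), (2, 2, 1, 1)),
    ([(1, 2, 2, 1), (2, 3, 1, 0)], (1, 3, 1, 1), (2, 2, 1, 1))]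

/-- The elements of the square of the ideal of `K₄` dividing `ab²c²d`. -/
def eightList : List Quad :=
  [(0, 1, 2, 1), (0, 2, 1, 1), (0, 2, 2, 0), (1, 0, 2, 1), (1, 1, 1, 1), (1, 1, 2, 0),
    (1, 2, 0, 1), (1, 2, 1, 0)]

/-- Candidates for sets with two pivots in `eightList`. -/
def eightListRules : Rules :=
  [([(0, 2, 2, 0), (1, 1, 1, 1)], (0, 1, 2, 1), (1, 2, 1, 0)),
    ([(0, 2, 2, 0), (1, 1, 1, 1)], (0, 2, 1, 1), (1, 1, 2, 0)),
    ([(0, 1, 2, 1), (1, 2, 1, 0)], (0, 2, 1, 1), (0, 2, 2, 0)),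
    ([(0, 2, 1, 1), (1, 1, 2, 0)], (0, 1, 2, 1), (0, 2, 2, 0)),
    ([(0, 2, 2, 0), (1, 1, 1, 1)], (0, 1, 2, 1), (0, 2, 1, 1)),
    ([(0, 1, 2, 1), (1, 2, 1, 0)], (0, 2, 2, 0), (1, 1, 1, 1)),
    ([(0, 2, 1, 1), (1, 1, 2, 0)], (0, 2, 2, 0), (1, 1, 1, 1)),
    ([(0, 1, 2, 1), (1, 2, 1, 0)], (0, 2, 1, 1), (1, 1, 2, 0)),
    ([(0, 2, 1, 1), (1, 1, 2, 0)], (0, 1, 2, 1), (1, 2, 1, 0)),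
    ([(0, 2, 2, 0), (1, 1, 1, 1)], (0, 1, 2, 1), (1, 1, 2, 0)),
    ([(0, 2, 2, 0), (1, 1, 1, 1)], (0, 2, 1, 1), (1, 2, 1, 0)),
    ([(0, 1, 2, 1), (1, 2, 1, 0)], (1, 1, 1, 1), (1, 1, 2, 0)),
    ([(0, 2, 1, 1), (1, 1, 2, 0)], (1, 1, 1, 1), (1, 2, 1, 0)),
    ([(0, 2, 1, 1), (1, 1, 2, 0)], (0, 1, 2, 1), (1, 1, 1, 1)),
    ([(0, 2, 1, 1), (1, 1, 2, 0)], (0, 2, 2, 0), (1, 2, 1, 0)),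
    ([(0, 1, 2, 1), (1, 2, 1, 0)], (0, 2, 1, 1), (1, 1, 1, 1)),
    ([(0, 1, 2, 1), (1, 2, 1, 0)], (0, 2, 2, 0), (1, 1, 2, 0)),
    ([(0, 1, 2, 1), (1, 2, 0, 1)], (0, 2, 1, 1), (1, 1, 1, 1)),
    ([(0, 2, 1, 1), (1, 0, 2, 1)], (0, 1, 2, 1), (1, 1, 1, 1)),
    ([(1, 0, 2, 1), (1, 2, 1, 0)], (1, 1, 1, 1), (1, 1, 2, 0)),
    ([(1, 1, 2, 0), (1, 2, 0, 1)], (1, 1, 1, 1), (1, 2, 1, 0)),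
    ([(0, 2, 2, 0), (1, 2, 0, 1)], (0, 2, 1, 1), (1, 2, 1, 0)),
    ([(0, 2, 2, 0), (1, 0, 2, 1)], (0, 1, 2, 1), (1, 1, 2, 0)),
    ([(0, 2, 2, 0), (1, 1, 1, 1)], (1, 1, 2, 0), (1, 2, 1, 0)),
    ([(0, 2, 1, 1), (1, 0, 2, 1)], (0, 1, 2, 1), (1, 2, 0, 1)),
    ([(1, 0, 2, 1), (1, 2, 1, 0)], (1, 1, 2, 0), (1, 2, 0, 1)),
    ([(0, 1, 2, 1), (1, 2, 0, 1)], (0, 2, 1, 1), (1, 0, 2, 1)),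
    ([(1, 1, 2, 0), (1, 2, 0, 1)], (1, 0, 2, 1), (1, 2, 1, 0))]

theorem Friendly.not_rhombusList {o : Quad → ℕ} (ho : Set.InjOn o {x | x ∈ rhombusList}) :
    ¬ Friendly rhombusList o := fun h => by
  have := h.refutes_eq_false ho (R := rhombusListRules) (k := 5) (by decide +kernel)
    (pre := []) trivial
  revert this
  decide +kernel

theorem Friendly.not_eightList {o : Quad → ℕ} (ho : Set.InjOn o {x | x ∈ eightList}) :
    ¬ Friendly eightList o := fun h => by
  have := h.refutes_eq_false ho (R := eightListRules) (k := 9) (by decide +kernel)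
    (pre := []) trivial
  revert this
  decide +kernel

theorem Friendly.sixList_le {o : Quad → ℕ} (h : Friendly sixList o)
    (ho : Set.InjOn o {x | x ∈ sixList}) {x : Quad} (hx : x ∈ sixList) :
    o (0, 2, 1, 1) ≤ o x :=
  h.le_of_refutes ho (R := sixListRules) (k := 8) (by decide +kernel) (by decide +kernel) hx

theorem Friendly.sixList'_le {o : Quad → ℕ} (h : Friendly sixList' o)
    (ho : Set.InjOn o {x | x ∈ sixList'}) {x : Quad} (hx : x ∈ sixList') :
    o (1, 2, 0, 1) ≤ o x :=
  h.le_of_refutes ho (R := sixList'Rules) (k := 8) (by decide +kernel) (by decide +kernel) hx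

theorem Friendly.sevenList_le {o : Quad → ℕ} (h : Friendly sevenList o)
    (ho : Set.InjOn o {x | x ∈ sevenList}) {x : Quad} (hx : x ∈ sevenList) :
    o (1, 3, 1, 1) ≤ o x :=
  h.le_of_refutes ho (R := sevenListRules) (k := 8) (by decide +kernel) (by decide +kernel) hx

/-- The monomials of degree 4 dividing `a²b²c²`. -/
def largeTriangle : List Quad :=
  [(0, 2, 2, 0), (2, 0, 2, 0), (2, 2, 0, 0), (1, 1, 2, 0), (1, 2, 1, 0), (2, 1, 1, 0)]

/-- Candidates for sets with two pivots in `largeTriangle`. -/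
def largeTriangleRules : Rules :=
  [([(0, 2, 2, 0), (2, 1, 1, 0)], (1, 1, 2, 0), (1, 2, 1, 0)),
    ([(0, 2, 2, 0), (2, 1, 1, 0)], (2, 0, 2, 0), (1, 2, 1, 0)),
    ([(0, 2, 2, 0), (2, 1, 1, 0)], (2, 2, 0, 0), (1, 1, 2, 0)),
    ([(0, 2, 2, 0), (2, 1, 1, 0)], (2, 0, 2, 0), (2, 2, 0, 0))]

/-- The monomials of degree 3 dividing `a²b²c`. -/
def mediumTriangle : List Quad :=
  [(0, 2, 1, 0), (2, 0, 1, 0), (1, 1, 1, 0), (1, 2, 0, 0), (2, 1, 0, 0)]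

/-- Candidates for sets with two pivots in `mediumTriangle`. -/
def mediumTriangleRules : Rules :=
  [([(0, 2, 1, 0), (2, 1, 0, 0)], (1, 1, 1, 0), (1, 2, 0, 0)),
    ([(0, 2, 1, 0), (2, 1, 0, 0)], (2, 0, 1, 0), (1, 2, 0, 0))]

/-- The monomials of degree 2 dividing `a²bc`. -/
def smallTriangle : List Quad := [(0, 1, 1, 0), (1, 0, 1, 0), (1, 1, 0, 0), (2, 0, 0, 0)]

theorem Friendly.exists_lt_of_refutes {L : List Quad} {o : Quad → ℕ} (h : Friendly L o)
    (ho : Set.InjOn o {x | x ∈ L}) {R : Rules} (hR : validRules L R) {k : ℕ} {s : Quad}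
    (hsL : s ∈ L) (hs : refutes L (ruleConds L R) k [s]) : ∃ x ∈ L, o x < o s := by
  by_contra! hmin
  have := h.refutes_eq_false (k := k) (pre := [s]) ho hR ⟨hsL, fun x hx hne =>
    lt_of_le_of_ne (hmin x hx) fun he => hne (ho hx hsL he.symm), trivial⟩
  simp [hs] at this

theorem Friendly.exists_lt_largeTriangle {o : Quad → ℕ} (h : Friendly largeTriangle o)
    (ho : Set.InjOn o {x | x ∈ largeTriangle}) : ∃ x ∈ largeTriangle, o x < o (0, 2, 2, 0) :=
  h.exists_lt_of_refutes ho (R := largeTriangleRules) (k := 6) (by decide +kernel) (by decide)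
    (by decide +kernel)

theorem Friendly.exists_lt_mediumTriangle {o : Quad → ℕ} (h : Friendly mediumTriangle o)
    (ho : Set.InjOn o {x | x ∈ mediumTriangle}) : ∃ x ∈ mediumTriangle, o x < o (0, 2, 1, 0) :=
  h.exists_lt_of_refutes ho (R := mediumTriangleRules) (k := 6) (by decide +kernel) (by decide)
    (by decide +kernel)

theorem Friendly.exists_lt_smallTriangle {o : Quad → ℕ} (h : Friendly smallTriangle o)
    (ho : Set.InjOn o {x | x ∈ smallTriangle}) :
    ∃ x ∈ [(1, 0, 1, 0), (1, 1, 0, 0)], o x < o (0, 1, 1, 0) := by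
  obtain ⟨p, hp, hle⟩ := h.exists_le
    [((0, 1, 1, 0), (1, 0, 1, 0)), ((0, 1, 1, 0), (1, 1, 0, 0))]
    (τ := [(0, 1, 1, 0), (2, 0, 0, 0)]) (q := (1, 0, 1, 0)) (r := (1, 1, 0, 0))
    (by decide) (by decide)
  simp only [List.mem_cons, List.not_mem_nil, or_false] at hp
  rcases hp with rfl | rfl
  · exact ⟨(1, 0, 1, 0), by decide, lt_of_le_of_ne hle fun he => absurd
      (ho (by decide : ((1, 0, 1, 0) : Quad) ∈ smallTriangle)
        (by decide : ((0, 1, 1, 0) : Quad) ∈ smallTriangle) he) (by decide)⟩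
  · exact ⟨(1, 1, 0, 0), by decide, lt_of_le_of_ne hle fun he => absurd
      (ho (by decide : ((1, 1, 0, 0) : Quad) ∈ smallTriangle)
        (by decide : ((0, 1, 1, 0) : Quad) ∈ smallTriangle) he) (by decide)⟩

end Certificates

section Monomials

theorem mem_edgePowGens_iff [Fintype V] {G : SimpleGraph V} {n : ℕ} {m : V → ℕ} :
    m ∈ edgePowGens G n ↔
      ∃ l : List (Sym2 V), l.length = n ∧ (∀ e ∈ l, e ∈ G.edgeSet) ∧ (l.map edgeMon).sum = m := by
  simp only [edgePowGens, Finset.mem_image, Finset.mem_filter, Finset.mem_univ, true_and]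
  constructor
  · rintro ⟨f, hf, rfl⟩
    refine ⟨List.ofFn f, by simp, fun e he => ?_, ?_⟩
    · obtain ⟨i, rfl⟩ := (List.mem_ofFn' f e).1 he
      exact hf i
    · rw [List.map_ofFn, List.sum_ofFn]; rfl
  · rintro ⟨l, rfl, hl, rfl⟩
    refine ⟨l.get, fun i => hl _ (l.get_mem i), ?_⟩
    conv_rhs => rw [← List.ofFn_get l, List.map_ofFn, List.sum_ofFn]
    rfl

theorem add_mem_edgePowGens [Fintype V] {G : SimpleGraph V} {n n' : ℕ} {m m' : V → ℕ}
    (h : m ∈ edgePowGens G n) (h' : m' ∈ edgePowGens G n') :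
    m + m' ∈ edgePowGens G (n + n') := by
  rw [mem_edgePowGens_iff] at *
  obtain ⟨l, rfl, hl, rfl⟩ := h
  obtain ⟨l', rfl, hl', rfl⟩ := h'
  refine ⟨l ++ l', by simp, fun e he => ?_, by simp⟩
  exact (List.mem_append.1 he).elim (hl e) (hl' e)

theorem smul_edgeMon_mem [Fintype V] {G : SimpleGraph V} {a b : V} {k : ℕ}
    (h : k = 0 ∨ G.Adj a b) : k • edgeMon s(a, b) ∈ edgePowGens G k := by
  rw [mem_edgePowGens_iff]
  refine ⟨List.replicate k s(a, b), by simp, fun e he => ?_, by simp⟩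
  obtain ⟨hk, rfl⟩ := List.mem_replicate.1 he
  exact h.resolve_left hk

theorem sum_edgePowGens [Fintype V] {G : SimpleGraph V} {n : ℕ} {m : V → ℕ}
    (h : m ∈ edgePowGens G n) : ∑ v, m v = 2 * n := by
  rw [mem_edgePowGens_iff] at h
  obtain ⟨l, rfl, hl, rfl⟩ := h
  induction l with
  | nil => simp
  | cons e l ih =>
    have ih := ih fun e he => hl e (List.mem_cons_of_mem _ he)
    have he := hl e List.mem_cons_self
    induction e with | h x y => ?_
    have hxy : x ≠ y := G.ne_of_adj he
    have : ∑ v, edgeMon s(x, y) v = 2 := by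
      rw [show (edgeMon s(x, y) : V → ℕ) =
          fun v => (if v = x then 1 else 0) + if v = y then 1 else 0
        from funext fun v => by
          by_cases h1 : v = x <;> by_cases h2 : v = y <;> simp_all [edgeMon]]
      simp [Finset.sum_add_distrib]
    simp only [List.map_cons, List.sum_cons, Pi.add_apply, Finset.sum_add_distrib, this, ih,
      List.length_cons]
    ring

/-- The monomial `a ^ i * b ^ j * c ^ k * d ^ l`. -/
def mon4 (a b c d : V) (i j k l : ℕ) : V → ℕ := fun v =>
  if v = a then i else if v = b then j else if v = c then k else if v = d then l else 0

/-- The vertices `a, b, c, d` are pairwise distinct. -/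
structure Distinct4 (a b c d : V) : Prop where
  ab : a ≠ b
  ac : a ≠ c
  ad : a ≠ d
  bc : b ≠ c
  bd : b ≠ d
  cd : c ≠ d

variable {a b c d : V}

theorem mon4_ext {m : V → ℕ} (hd : Distinct4 a b c d) {i j k l : ℕ} :
    m = mon4 a b c d i j k l ↔ m a = i ∧ m b = j ∧ m c = k ∧ m d = l ∧
      ∀ v, v ≠ a → v ≠ b → v ≠ c → v ≠ d → m v = 0 := by
  obtain ⟨hab, hac, had, hbc, hbd, hcd⟩ := hd
  constructor
  · rintro rfl
    refine ⟨?_, ?_, ?_, ?_, fun v h1 h2 h3 h4 => ?_⟩ <;> simp [mon4, *, Ne.symm]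
  · rintro ⟨rfl, rfl, rfl, rfl, h⟩
    funext v
    unfold mon4
    split_ifs <;> simp_all

/-- `a ^ i * b ^ j * c ^ k * d ^ l` is the product of `n` edges of the graph induced on
`a, b, c, d`. -/
def IsPow4 (G : SimpleGraph V) (a b c d : V) (n i j k l : ℕ) : Prop :=
  ∃ ab ac ad bc bd cd : ℕ, ab + ac + ad + bc + bd + cd = n ∧ ab + ac + ad = i ∧
    ab + bc + bd = j ∧ ac + bc + cd = k ∧ ad + bd + cd = l ∧ (ab = 0 ∨ G.Adj a b) ∧
    (ac = 0 ∨ G.Adj a c) ∧ (ad = 0 ∨ G.Adj a d) ∧ (bc = 0 ∨ G.Adj b c) ∧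
    (bd = 0 ∨ G.Adj b d) ∧ (cd = 0 ∨ G.Adj c d)

theorem isPow4_of_sum {G : SimpleGraph V} (hd : Distinct4 a b c d) {l : List (Sym2 V)}
    (hl : ∀ e ∈ l, e ∈ G.edgeSet)
    (h : ∀ v, v ≠ a → v ≠ b → v ≠ c → v ≠ d → (l.map edgeMon).sum v = 0) :
    IsPow4 G a b c d l.length ((l.map edgeMon).sum a) ((l.map edgeMon).sum b)
      ((l.map edgeMon).sum c) ((l.map edgeMon).sum d) := by
  induction l with
  | nil => exact ⟨0, 0, 0, 0, 0, 0, by simp⟩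
  | cons e l ih =>
    simp only [List.map_cons, List.sum_cons, Pi.add_apply, Nat.add_eq_zero_iff,
      List.length_cons] at h ⊢
    obtain ⟨ab, ac, ad, bc, bd, cd, h0, h1, h2, h3, h4, h5, h6, h7, h8, h9, h10⟩ :=
      ih (fun e he => hl e (List.mem_cons_of_mem _ he)) fun v v1 v2 v3 v4 => (h v v1 v2 v3 v4).2
    rw [← h0, ← h1, ← h2, ← h3, ← h4]
    have he := hl e List.mem_cons_self
    induction e with | h x y => ?_
    have hxy : G.Adj x y := he
    have hmem : ∀ v ∈ s(x, y), v = a ∨ v = b ∨ v = c ∨ v = d := fun v hv => by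
      by_contra! hv'
      have := (h v hv'.1 hv'.2.1 hv'.2.2.1 hv'.2.2.2).1
      simp [edgeMon, hv] at this
    obtain ⟨hab, hac, had, hbc, hbd, hcd⟩ := hd
    rcases hmem x (Sym2.mem_mk_left x y) with rfl | rfl | rfl | rfl <;>
    rcases hmem y (Sym2.mem_mk_right x y) with rfl | rfl | rfl | rfl <;>
    first
    | exact (G.loopless.irrefl _ hxy).elim
    | simp only [edgeMon, Sym2.mem_iff, hab, hac, had, hbc, hbd, hcd, hab.symm, hac.symm,
        had.symm, hbc.symm, hbd.symm, hcd.symm, or_self, or_true, or_false, if_true, if_false]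
    all_goals first
    | exact ⟨ab + 1, ac, ad, bc, bd, cd, by omega, by omega, by omega, by omega, by omega,
        Or.inr (by first | exact hxy | exact hxy.symm), h6, h7, h8, h9, h10⟩
    | exact ⟨ab, ac + 1, ad, bc, bd, cd, by omega, by omega, by omega, by omega, by omega,
        h5, Or.inr (by first | exact hxy | exact hxy.symm), h7, h8, h9, h10⟩
    | exact ⟨ab, ac, ad + 1, bc, bd, cd, by omega, by omega, by omega, by omega, by omega,
        h5, h6, Or.inr (by first | exact hxy | exact hxy.symm), h8, h9, h10⟩
    | exact ⟨ab, ac, ad, bc + 1, bd, cd, by omega, by omega, by omega, by omega, by omega,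
        h5, h6, h7, Or.inr (by first | exact hxy | exact hxy.symm), h9, h10⟩
    | exact ⟨ab, ac, ad, bc, bd + 1, cd, by omega, by omega, by omega, by omega, by omega,
        h5, h6, h7, h8, Or.inr (by first | exact hxy | exact hxy.symm), h10⟩
    | exact ⟨ab, ac, ad, bc, bd, cd + 1, by omega, by omega, by omega, by omega, by omega,
        h5, h6, h7, h8, h9, Or.inr (by first | exact hxy | exact hxy.symm)⟩

theorem mon4_mem_iff [Fintype V] {G : SimpleGraph V} (hd : Distinct4 a b c d)
    {n i j k l : ℕ} : mon4 a b c d i j k l ∈ edgePowGens G n ↔ IsPow4 G a b c d n i j k l := by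
  constructor
  · intro h
    obtain ⟨e, rfl, hl, he⟩ := mem_edgePowGens_iff.1 h
    obtain ⟨h1, h2, h3, h4, h5⟩ := (mon4_ext hd).1 he
    have := isPow4_of_sum hd hl h5
    rwa [h1, h2, h3, h4] at this
  · rintro ⟨ab, ac, ad, bc, bd, cd, rfl, rfl, rfl, rfl, rfl, h1, h2, h3, h4, h5, h6⟩
    convert add_mem_edgePowGens (add_mem_edgePowGens (add_mem_edgePowGens (add_mem_edgePowGens
      (add_mem_edgePowGens (smul_edgeMon_mem h1) (smul_edgeMon_mem h2)) (smul_edgeMon_mem h3))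
      (smul_edgeMon_mem h4)) (smul_edgeMon_mem h5)) (smul_edgeMon_mem h6) using 1
    symm
    rw [mon4_ext hd]
    obtain ⟨hab, hac, had, hbc, hbd, hcd⟩ := hd
    refine ⟨?_, ?_, ?_, ?_, fun v v1 v2 v3 v4 => ?_⟩ <;>
      simp [edgeMon, *, Ne.symm]

theorem exists_mon4 [Fintype V] {G : SimpleGraph V} {n : ℕ} (hd : Distinct4 a b c d) {m : V → ℕ}
    (hm : m ∈ edgePowGens G n) (h : ∀ v, v ≠ a → v ≠ b → v ≠ c → v ≠ d → m v = 0) :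
    ∃ i j k l, m = mon4 a b c d i j k l ∧ IsPow4 G a b c d n i j k l := by
  have he : m = mon4 a b c d (m a) (m b) (m c) (m d) := (mon4_ext hd).2 ⟨rfl, rfl, rfl, rfl, h⟩
  exact ⟨_, _, _, _, he, (mon4_mem_iff hd).1 (he ▸ hm)⟩

theorem mon4_swap_left (hab : a ≠ b) {i j k l : ℕ} :
    mon4 b a c d j i k l = mon4 a b c d i j k l := by
  funext v
  unfold mon4
  split_ifs <;> simp_all

theorem mon4_swap_middle (hbc : b ≠ c) {i j k l : ℕ} :
    mon4 a c b d i k j l = mon4 a b c d i j k l := by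
  funext v
  unfold mon4
  split_ifs <;> simp_all

theorem Distinct4.swap_left (hd : Distinct4 a b c d) : Distinct4 b a c d :=
  ⟨hd.ab.symm, hd.bc, hd.bd, hd.ac, hd.ad, hd.cd⟩

theorem Distinct4.swap_middle (hd : Distinct4 a b c d) : Distinct4 a c b d :=
  ⟨hd.ac, hd.ab, hd.ad, hd.bc.symm, hd.cd, hd.bd⟩

end Monomials

section Boxes

theorem covers_iff_exists {S : List Quad} {x : Quad} : covers S x = true ↔
    (∃ y ∈ S, x.1 ≤ y.1) ∧ (∃ y ∈ S, x.2.1 ≤ y.2.1) ∧ (∃ y ∈ S, x.2.2.1 ≤ y.2.2.1) ∧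
      ∃ y ∈ S, x.2.2.2 ≤ y.2.2.2 := by
  simp [covers, and_assoc]

theorem zero_notMem_edgePowGens [Fintype V] {G : SimpleGraph V} {n : ℕ} (hn : 0 < n) :
    0 ∉ edgePowGens G n := fun h => by
  have := sum_edgePowGens h
  simp at this
  omega

theorem le_mlcm_encoded_iff {φ : Quad → V → ℕ} {S : List Quad} {x : Quad} (h0 : φ x ≠ 0) :
    φ x ≤ mlcm (encoded φ S) ↔ S ≠ [] ∧ ∀ v, ∃ y ∈ S, φ x v ≤ φ y v := by
  rw [le_mlcm_iff]
  have he : ∀ v, (∃ g ∈ encoded φ S, φ x v ≤ g v) ↔ ∃ y ∈ S, φ x v ≤ φ y v := fun v => by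
    simp only [mem_encoded]
    exact ⟨fun ⟨_, ⟨y, hy, rfl⟩, h⟩ => ⟨y, hy, h⟩, fun ⟨y, hy, h⟩ => ⟨_, ⟨y, hy, rfl⟩, h⟩⟩
  simp only [he]
  constructor
  · intro h
    obtain ⟨v, hv⟩ := Function.ne_iff.1 h0
    have hS : S ≠ [] := fun hS => by simpa [hS] using (h v).resolve_left hv
    refine ⟨hS, fun v => (h v).elim (fun h => ?_) id⟩
    obtain ⟨y, hy⟩ := List.exists_mem_of_ne_nil S hS
    exact ⟨y, hy, h ▸ Nat.zero_le _⟩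
  · exact fun h v => Or.inr (h.2 v)

/-- The list `S` lies below the exponent vector `B`. -/
def below (S : List Quad) (B : Quad) : Bool :=
  S.all fun x => Nat.ble x.1 B.1 && Nat.ble x.2.1 B.2.1 && Nat.ble x.2.2.1 B.2.2.1 &&
    Nat.ble x.2.2.2 B.2.2.2

theorem encodes_mon4 [Fintype V] {G : SimpleGraph V} {a b c d : V} (hd : Distinct4 a b c d)
    {n : ℕ} (hn : 0 < n) {L : List Quad} (B : Quad) (hB : below L B) (s t u w : ℕ)
    (hmem : ∀ x ∈ L, IsPow4 G a b c d n (x.1 + s) (x.2.1 + t) (x.2.2.1 + u) (x.2.2.2 + w))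
    (hex : ∀ i j k l, IsPow4 G a b c d n i j k l → i ≤ B.1 + s → j ≤ B.2.1 + t →
      k ≤ B.2.2.1 + u → l ≤ B.2.2.2 + w →
      ∃ x ∈ L, x.1 + s = i ∧ x.2.1 + t = j ∧ x.2.2.1 + u = k ∧ x.2.2.2 + w = l) :
    Encodes (fun x => mon4 a b c d (x.1 + s) (x.2.1 + t) (x.2.2.1 + u) (x.2.2.2 + w)) L
      (edgePowGens G n) := by
  have hval : ∀ i j k l, mon4 a b c d i j k l a = i ∧ mon4 a b c d i j k l b = j ∧
      mon4 a b c d i j k l c = k ∧ mon4 a b c d i j k l d = l ∧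
      ∀ v, v ≠ a → v ≠ b → v ≠ c → v ≠ d → mon4 a b c d i j k l v = 0 :=
    fun i j k l => (mon4_ext hd).1 rfl
  have hmem' : ∀ x ∈ L, mon4 a b c d (x.1 + s) (x.2.1 + t) (x.2.2.1 + u) (x.2.2.2 + w) ∈
      edgePowGens G n := fun x hx => (mon4_mem_iff hd).2 (hmem x hx)
  refine ⟨hmem', ?_, ?_, ?_⟩
  · rintro ⟨x1, x2, x3, x4⟩ - ⟨y1, y2, y3, y4⟩ - he
    obtain ⟨h1, h2, h3, h4, -⟩ := (mon4_ext hd).1 he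
    obtain ⟨h1', h2', h3', h4', -⟩ := hval (x1 + s) (x2 + t) (x3 + u) (x4 + w)
    simp only at h1 h2 h3 h4
    simp only [Prod.mk.injEq]
    omega
  · intro m hm hle
    simp only [below, List.all_eq_true, Bool.and_eq_true, Nat.ble_eq] at hB
    rw [le_mlcm_iff] at hle
    simp only [mem_encoded] at hle
    obtain ⟨i, j, k, l, rfl, hp⟩ := exists_mon4 hd hm fun v h1 h2 h3 h4 => by
      rcases hle v with h | ⟨_, ⟨x, -, rfl⟩, h⟩
      · exact h
      · simpa [(hval _ _ _ _).2.2.2.2 v h1 h2 h3 h4] using h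
    have ha := hle a
    have hb := hle b
    have hc := hle c
    have hd' := hle d
    rw [(hval i j k l).1] at ha
    rw [(hval i j k l).2.1] at hb
    rw [(hval i j k l).2.2.1] at hc
    rw [(hval i j k l).2.2.2.1] at hd'
    obtain ⟨x, hx, h1, h2, h3, h4⟩ := hex i j k l hp
      (by
        rcases ha with h | ⟨_, ⟨x, hx, rfl⟩, h⟩
        · omega
        · rw [(hval _ _ _ _).1] at h; have := hB x hx; omega)
      (by
        rcases hb with h | ⟨_, ⟨x, hx, rfl⟩, h⟩
        · omega
        · rw [(hval _ _ _ _).2.1] at h; have := hB x hx; omega)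
      (by
        rcases hc with h | ⟨_, ⟨x, hx, rfl⟩, h⟩
        · omega
        · rw [(hval _ _ _ _).2.2.1] at h; have := hB x hx; omega)
      (by
        rcases hd' with h | ⟨_, ⟨x, hx, rfl⟩, h⟩
        · omega
        · rw [(hval _ _ _ _).2.2.2.1] at h; have := hB x hx; omega)
    exact ⟨x, hx, by rw [h1, h2, h3, h4]⟩
  · intro S hS x hx
    have h0 : mon4 a b c d (x.1 + s) (x.2.1 + t) (x.2.2.1 + u) (x.2.2.2 + w) ≠ 0 :=
      fun h => zero_notMem_edgePowGens hn (h ▸ hmem' x hx)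
    rw [le_mlcm_encoded_iff (φ := fun x : Quad => mon4 a b c d (x.1 + s) (x.2.1 + t)
      (x.2.2.1 + u) (x.2.2.2 + w)) h0, covers_iff_exists]
    constructor
    · rintro ⟨⟨y, hy, h1⟩, ⟨y2, hy2, h2⟩, ⟨y3, hy3, h3⟩, ⟨y4, hy4, h4⟩⟩
      refine ⟨List.ne_nil_of_mem hy, fun v => ?_⟩
      unfold mon4
      by_cases ha : v = a
      · exact ⟨y, hy, by simp [ha, h1]⟩
      by_cases hb : v = b
      · exact ⟨y2, hy2, by simp [hb, hd.ab.symm, h2]⟩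
      by_cases hc : v = c
      · exact ⟨y3, hy3, by simp [hc, hd.ac.symm, hd.bc.symm, h3]⟩
      by_cases hd' : v = d
      · exact ⟨y4, hy4, by simp [hd', hd.ad.symm, hd.bd.symm, hd.cd.symm, h4]⟩
      · exact ⟨y, hy, by simp [ha, hb, hc, hd']⟩
    · rintro ⟨-, h⟩
      have ha := h a
      have hb := h b
      have hc := h c
      have hd' := h d
      simp only [(hval _ _ _ _).1] at ha
      simp only [(hval _ _ _ _).2.1] at hb
      simp only [(hval _ _ _ _).2.2.1] at hc
      simp only [(hval _ _ _ _).2.2.2.1] at hd'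
      simp only [Nat.add_le_add_iff_right] at ha hb hc hd'
      exact ⟨ha, hb, hc, hd'⟩

end Boxes

section Obstructions

variable [Fintype V] {G : SimpleGraph V} {a b c d : V} {n : ℕ} {ord : (V → ℕ) → ℕ}

theorem not_bridgeFriendlyWrt_of_rhombus (hd : Distinct4 a b c d) (hn : 2 ≤ n) (hab : G.Adj a b)
    (hbc : G.Adj b c) (hcd : G.Adj c d) (hac : ¬ G.Adj a c) (hbd : ¬ G.Adj b d)
    (hord : Set.InjOn ord (edgePowGens G n)) : ¬ BridgeFriendlyWrt (edgePowGens G n) ord := by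
  intro hM
  obtain ⟨n, rfl⟩ := Nat.exists_eq_add_of_le' hn
  have he := encodes_mon4 (G := G) (n := n + 2) (L := rhombusList) hd (by omega) (1, 1, 1, 1)
    (by decide) 0 (n + 1) (n + 1) 0
    (by
      simp only [rhombusList, List.forall_mem_cons, List.not_mem_nil, false_imp_iff,
        implies_true, and_true]
      refine ⟨⟨0, 0, 0, n + 2, 0, 0, ?_⟩, ⟨1, 0, 0, n + 1, 0, 0, ?_⟩, ⟨0, 0, 0, n + 1, 0, 1, ?_⟩,
        ⟨1, 0, 0, n, 0, 1, ?_⟩⟩ <;> simp [*] <;> omega)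
    (by
      rintro i j k l ⟨ab, ac, ad, bc, bd, cd, h0, h1, h2, h3, h4, -, h6, -, -, h9, -⟩ hi hj hk hl
      dsimp only at hi hj hk hl
      have h6 := h6.resolve_right hac
      have h9 := h9.resolve_right hbd
      obtain ⟨j', rfl⟩ := Nat.exists_eq_add_of_le' (show n + 1 ≤ j by omega)
      obtain ⟨k', rfl⟩ := Nat.exists_eq_add_of_le' (show n + 1 ≤ k by omega)
      simp only [add_le_add_iff_right] at hi hj hk hl
      interval_cases i <;> interval_cases l <;> interval_cases j' <;> interval_cases k' <;>
      first
      | omega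
      | exact ⟨(_, _, _, _), by decide, rfl, rfl, rfl, rfl⟩)
  exact Friendly.not_rhombusList (he.injOn hord) (he.friendly hord hM)

theorem not_bridgeFriendlyWrt_of_complete (hd : Distinct4 a b c d) (hn : 2 ≤ n)
    (hab : G.Adj a b) (hbc : G.Adj b c) (hcd : G.Adj c d) (hac : G.Adj a c) (hbd : G.Adj b d)
    (hord : Set.InjOn ord (edgePowGens G n)) : ¬ BridgeFriendlyWrt (edgePowGens G n) ord := by
  intro hM
  obtain ⟨n, rfl⟩ := Nat.exists_eq_add_of_le' hn
  have he := encodes_mon4 (G := G) (n := n + 2) (L := eightList) hd (by omega) (1, 2, 2, 1)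
    (by decide) 0 n n 0
    (by
      simp only [eightList, List.forall_mem_cons, List.not_mem_nil, false_imp_iff,
        implies_true, and_true]
      refine ⟨⟨0, 0, 0, n + 1, 0, 1, ?_⟩, ⟨0, 0, 0, n + 1, 1, 0, ?_⟩, ⟨0, 0, 0, n + 2, 0, 0, ?_⟩,
        ⟨0, 1, 0, n, 0, 1, ?_⟩, ⟨1, 0, 0, n, 0, 1, ?_⟩, ⟨0, 1, 0, n + 1, 0, 0, ?_⟩,
        ⟨1, 0, 0, n, 1, 0, ?_⟩, ⟨1, 0, 0, n + 1, 0, 0, ?_⟩⟩ <;> simp [*] <;> omega)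
    (by
      rintro i j k l ⟨ab, ac, ad, bc, bd, cd, h0, h1, h2, h3, h4, -⟩ hi hj hk hl
      dsimp only at hi hj hk hl
      obtain ⟨j', rfl⟩ := Nat.exists_eq_add_of_le' (show n ≤ j by omega)
      obtain ⟨k', rfl⟩ := Nat.exists_eq_add_of_le' (show n ≤ k by omega)
      simp only [add_le_add_iff_right] at hi hj hk hl
      interval_cases i <;> interval_cases l <;> interval_cases j' <;> interval_cases k' <;>
      first
      | omega
      | exact ⟨(_, _, _, _), by decide, rfl, rfl, rfl, rfl⟩)
  exact Friendly.not_eightList (he.injOn hord) (he.friendly hord hM)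

/-- The elements of the square of the paw ideal dividing `a²b²cd`. -/
def pawList : List Quad := [(2, 2, 0, 0), (1, 2, 1, 0), (1, 2, 0, 1), (0, 2, 1, 1), (1, 1, 1, 1)]

theorem encodes_sixList (hd : Distinct4 a b c d) {n : ℕ} (hab : G.Adj a b) (hbc : G.Adj b c)
    (hcd : G.Adj c d) (hbd : G.Adj b d) (hac : ¬ G.Adj a c) :
    Encodes (fun x => mon4 a b c d (x.1 + 0) (x.2.1 + n) (x.2.2.1 + n) (x.2.2.2 + 0))
      sixList (edgePowGens G (n + 2)) :=
  encodes_mon4 hd (by omega) (1, 2, 2, 1) (by decide) 0 n n 0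
    (by
      simp only [sixList, List.forall_mem_cons, List.not_mem_nil, false_imp_iff,
        implies_true, and_true]
      refine ⟨⟨0, 0, 0, n + 1, 0, 1, ?_⟩, ⟨0, 0, 0, n + 1, 1, 0, ?_⟩, ⟨0, 0, 0, n + 2, 0, 0, ?_⟩,
        ⟨1, 0, 0, n, 0, 1, ?_⟩, ⟨1, 0, 0, n, 1, 0, ?_⟩,
        ⟨1, 0, 0, n + 1, 0, 0, ?_⟩⟩ <;> simp [*] <;> omega)
    (by
      rintro i j k l ⟨ab, ac, ad, bc, bd, cd, h0, h1, h2, h3, h4, -, h6, -, -, -, -⟩ hi hj hk hl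
      dsimp only at hi hj hk hl
      have h6 := h6.resolve_right hac
      obtain ⟨j', rfl⟩ := Nat.exists_eq_add_of_le' (show n ≤ j by omega)
      obtain ⟨k', rfl⟩ := Nat.exists_eq_add_of_le' (show n ≤ k by omega)
      simp only [add_le_add_iff_right] at hi hj hk hl
      interval_cases i <;> interval_cases j' <;> interval_cases k' <;> interval_cases l <;>
      first
      | omega
      | exact ⟨(_, _, _, _), by decide, rfl, rfl, rfl, rfl⟩)

theorem encodes_sixList' (hd : Distinct4 a b c d) (hab : G.Adj a b) (hbc : G.Adj b c)
    (hcd : G.Adj c d) (hbd : G.Adj b d) (had : G.Adj a d) (hac : ¬ G.Adj a c) :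
    Encodes (fun x => mon4 a b c d (x.1 + 0) (x.2.1 + 0) (x.2.2.1 + 0) (x.2.2.2 + 0))
      sixList' (edgePowGens G (2)) :=
  encodes_mon4 hd (by omega) (2, 2, 1, 1) (by decide) 0 0 0 0
    (by
      simp only [sixList', List.forall_mem_cons, List.not_mem_nil, false_imp_iff,
        implies_true, and_true]
      refine ⟨⟨0, 0, 0, 1, 1, 0, ?_⟩, ⟨1, 0, 0, 0, 0, 1, ?_⟩, ⟨1, 0, 0, 0, 1, 0, ?_⟩,
        ⟨1, 0, 0, 1, 0, 0, ?_⟩, ⟨1, 0, 1, 0, 0, 0, ?_⟩, ⟨2, 0, 0, 0, 0, 0, ?_⟩⟩ <;> simp [*])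
    (by
      rintro i j k l ⟨ab, ac, ad, bc, bd, cd, h0, h1, h2, h3, h4, -, h6, -, -, -, -⟩ hi hj hk hl
      dsimp only at hi hj hk hl
      have h6 := h6.resolve_right hac
      interval_cases i <;> interval_cases j <;> interval_cases k <;> interval_cases l <;>
      first
      | omega
      | exact ⟨(_, _, _, _), by decide, rfl, rfl, rfl, rfl⟩)

theorem encodes_sevenList_of_adj (hd : Distinct4 a b c d) {n : ℕ} (hab : G.Adj a b)
    (hbc : G.Adj b c) (hcd : G.Adj c d) (hbd : G.Adj b d) (hac : ¬ G.Adj a c) :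
    Encodes (fun x => mon4 a b c d (x.1 + 0) (x.2.1 + n) (x.2.2.1 + n) (x.2.2.2 + 0))
      sevenList (edgePowGens G (n + 3)) :=
  encodes_mon4 hd (by omega) (2, 3, 2, 1) (by decide) 0 n n 0
    (by
      simp only [sevenList, List.forall_mem_cons, List.not_mem_nil, false_imp_iff,
        implies_true, and_true]
      refine ⟨⟨0, 0, 0, n + 2, 1, 0, ?_⟩, ⟨1, 0, 0, n + 1, 0, 1, ?_⟩, ⟨1, 0, 0, n + 1, 1, 0, ?_⟩,
        ⟨1, 0, 0, n + 2, 0, 0, ?_⟩, ⟨2, 0, 0, n, 0, 1, ?_⟩, ⟨2, 0, 0, n, 1, 0, ?_⟩,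
        ⟨2, 0, 0, n + 1, 0, 0, ?_⟩⟩ <;> simp [*] <;> omega)
    (by
      rintro i j k l ⟨ab, ac, ad, bc, bd, cd, h0, h1, h2, h3, h4, -, h6, -, -, -, -⟩ hi hj hk hl
      dsimp only at hi hj hk hl
      have h6 := h6.resolve_right hac
      obtain ⟨j', rfl⟩ := Nat.exists_eq_add_of_le' (show n ≤ j by omega)
      obtain ⟨k', rfl⟩ := Nat.exists_eq_add_of_le' (show n ≤ k by omega)
      simp only [add_le_add_iff_right] at hi hj hk hl
      interval_cases i <;> interval_cases j' <;> interval_cases k' <;> interval_cases l <;>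
      first
      | omega
      | exact ⟨(_, _, _, _), by decide, rfl, rfl, rfl, rfl⟩)

theorem encodes_sevenList_of_not_adj (hd : Distinct4 a b c d) {n : ℕ} (hab : G.Adj a b)
    (hbc : G.Adj b c) (hcd : G.Adj c d) (hbd : G.Adj b d) (hac : ¬ G.Adj a c) (had : ¬ G.Adj a d) :
    Encodes (fun x => mon4 a b c d (x.1 + n) (x.2.1 + n) (x.2.2.1 + 0) (x.2.2.2 + 0))
      sevenList (edgePowGens G (n + 3)) :=
  encodes_mon4 hd (by omega) (2, 3, 2, 1) (by decide) n n 0 0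
    (by
      simp only [sevenList, List.forall_mem_cons, List.not_mem_nil, false_imp_iff,
        implies_true, and_true]
      refine ⟨⟨n, 0, 0, 2, 1, 0, ?_⟩, ⟨n + 1, 0, 0, 1, 0, 1, ?_⟩, ⟨n + 1, 0, 0, 1, 1, 0, ?_⟩,
        ⟨n + 1, 0, 0, 2, 0, 0, ?_⟩, ⟨n + 2, 0, 0, 0, 0, 1, ?_⟩, ⟨n + 2, 0, 0, 0, 1, 0, ?_⟩,
        ⟨n + 2, 0, 0, 1, 0, 0, ?_⟩⟩ <;> simp [*] <;> omega)
    (by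
      rintro i j k l ⟨ab, ac, ad, bc, bd, cd, h0, h1, h2, h3, h4, -, h6, h7, -, -, -⟩ hi hj hk hl
      dsimp only at hi hj hk hl
      have h6 := h6.resolve_right hac
      have h7 := h7.resolve_right had
      obtain ⟨i', rfl⟩ := Nat.exists_eq_add_of_le' (show n ≤ i by omega)
      obtain ⟨j', rfl⟩ := Nat.exists_eq_add_of_le' (show n ≤ j by omega)
      simp only [add_le_add_iff_right] at hi hj hk hl
      interval_cases i' <;> interval_cases j' <;> interval_cases k <;> interval_cases l <;>
      first
      | omega
      | exact ⟨(_, _, _, _), by decide, rfl, rfl, rfl, rfl⟩)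

theorem encodes_pawList (hd : Distinct4 a b c d) {n : ℕ} (hab : G.Adj a b) (hbc : G.Adj b c)
    (hcd : G.Adj c d) (hbd : G.Adj b d) (hac : ¬ G.Adj a c) (had : ¬ G.Adj a d) :
    Encodes (fun x => mon4 a b c d (x.1 + n) (x.2.1 + n) (x.2.2.1 + 0) (x.2.2.2 + 0))
      pawList (edgePowGens G (n + 2)) :=
  encodes_mon4 hd (by omega) (2, 2, 1, 1) (by decide) n n 0 0
    (by
      simp only [pawList, List.forall_mem_cons, List.not_mem_nil, false_imp_iff,
        implies_true, and_true]
      refine ⟨⟨n + 2, 0, 0, 0, 0, 0, ?_⟩, ⟨n + 1, 0, 0, 1, 0, 0, ?_⟩, ⟨n + 1, 0, 0, 0, 1, 0, ?_⟩,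
        ⟨n, 0, 0, 1, 1, 0, ?_⟩, ⟨n + 1, 0, 0, 0, 0, 1, ?_⟩⟩ <;> simp [*] <;> omega)
    (by
      rintro i j k l ⟨ab, ac, ad, bc, bd, cd, h0, h1, h2, h3, h4, -, h6, h7, -, -, -⟩ hi hj hk hl
      dsimp only at hi hj hk hl
      have h6 := h6.resolve_right hac
      have h7 := h7.resolve_right had
      obtain ⟨i', rfl⟩ := Nat.exists_eq_add_of_le' (show n ≤ i by omega)
      obtain ⟨j', rfl⟩ := Nat.exists_eq_add_of_le' (show n ≤ j by omega)
      simp only [add_le_add_iff_right] at hi hj hk hl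
      interval_cases i' <;> interval_cases j' <;> interval_cases k <;> interval_cases l <;>
      first
      | omega
      | exact ⟨(_, _, _, _), by decide, rfl, rfl, rfl, rfl⟩)

theorem not_bridgeFriendlyWrt_of_paw (hd : Distinct4 a b c d) (hn : 2 ≤ n) (hab : G.Adj a b)
    (hbc : G.Adj b c) (hcd : G.Adj c d) (hbd : G.Adj b d) (hac : ¬ G.Adj a c) (had : ¬ G.Adj a d)
    (hord : Set.InjOn ord (edgePowGens G n)) : ¬ BridgeFriendlyWrt (edgePowGens G n) ord := by
  intro hM
  obtain ⟨n, rfl⟩ := Nat.exists_eq_add_of_le' hn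
  have hmin : ∀ i j k l, (i, j, k, l) ∈ [(1, 2, 1, 0), (1, 2, 0, 1), (1, 1, 1, 1)] →
      ord (mon4 a b c d n (n + 2) 1 1) ≤ ord (mon4 a b c d (i + n) (j + n) k l) := by
    simp only [List.mem_cons, Prod.mk.injEq, List.not_mem_nil, or_false]
    rcases n with _ | n
    · have he := encodes_sixList (n := 0) hd hab hbc hcd hbd hac
      have hle := fun x => (he.friendly hord hM).sixList_le (he.injOn hord) (x := x)
      rintro i j k l (⟨rfl, rfl, rfl, rfl⟩ | ⟨rfl, rfl, rfl, rfl⟩ | ⟨rfl, rfl, rfl, rfl⟩)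
      · exact hle (1, 2, 1, 0) (by decide)
      · exact hle (1, 2, 0, 1) (by decide)
      · exact hle (1, 1, 1, 1) (by decide)
    · have he := encodes_sevenList_of_not_adj (n := n) hd hab hbc hcd hbd hac had
      have hle := fun x => (he.friendly hord hM).sevenList_le (he.injOn hord) (x := x)
      simp only [add_comm, add_left_comm] at hle ⊢
      rintro i j k l (⟨rfl, rfl, rfl, rfl⟩ | ⟨rfl, rfl, rfl, rfl⟩ | ⟨rfl, rfl, rfl, rfl⟩)
      · simpa [add_left_comm] using hle (2, 3, 1, 0) (by decide)
      · simpa [add_left_comm] using hle (2, 3, 0, 1) (by decide)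
      · simpa [add_left_comm] using hle (2, 2, 1, 1) (by decide)
  have he := encodes_pawList (n := n) hd hab hbc hcd hbd hac had
  obtain ⟨p, hp, hle⟩ := (he.friendly hord hM).exists_le
    [((0, 2, 1, 1), (1, 2, 1, 0)), ((0, 2, 1, 1), (1, 2, 0, 1)), ((0, 2, 1, 1), (1, 1, 1, 1))]
    (τ := [(2, 2, 0, 0), (0, 2, 1, 1)]) (q := (1, 2, 1, 0)) (r := (1, 2, 0, 1))
    (by decide) (by decide)
  have hinj := he.injOn hord
  have hne : ∀ x ∈ [(1, 2, 1, 0), (1, 2, 0, 1), (1, 1, 1, 1)],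
      ¬ ord (mon4 a b c d (x.1 + n) (x.2.1 + n) x.2.2.1 x.2.2.2) ≤
        ord (mon4 a b c d n (n + 2) 1 1) := by
    intro x hx hle
    have h1 := le_antisymm hle (hmin _ _ _ _ hx)
    have h2 : x = (0, 2, 1, 1) := hinj
      ((by decide : ∀ y ∈ [(1, 2, 1, 0), (1, 2, 0, 1), (1, 1, 1, 1)], y ∈ pawList) x hx) (by decide)
      (by simpa [add_comm] using h1)
    revert hx
    rw [h2]
    decide
  simp only [List.mem_cons, List.not_mem_nil, or_false] at hp
  rcases hp with rfl | rfl | rfl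
  · exact hne (1, 2, 1, 0) (by decide) (by simpa [add_comm] using hle)
  · exact hne (1, 2, 0, 1) (by decide) (by simpa [add_comm] using hle)
  · exact hne (1, 1, 1, 1) (by decide) (by simpa [add_comm] using hle)

theorem not_bridgeFriendlyWrt_of_diamond (hd : Distinct4 a b c d) (hn : 2 ≤ n) (hab : G.Adj a b)
    (hbc : G.Adj b c) (hcd : G.Adj c d) (hbd : G.Adj b d) (had : G.Adj a d) (hac : ¬ G.Adj a c)
    (hord : Set.InjOn ord (edgePowGens G n)) : ¬ BridgeFriendlyWrt (edgePowGens G n) ord := by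
  intro hM
  obtain ⟨n, rfl⟩ := Nat.exists_eq_add_of_le' hn
  have he := encodes_sixList (n := n) hd hab hbc hcd hbd hac
  have h1 := (he.friendly hord hM).sixList_le (he.injOn hord) (x := (1, 2, 0, 1)) (by decide)
  have hne : ord (mon4 a b c d 1 (n + 2) n 1) ≠ ord (mon4 a b c d 0 (n + 2) (n + 1) 1) := by
    have := he.injOn hord (by decide : ((1, 2, 0, 1) : Quad) ∈ sixList)
      (by decide : ((0, 2, 1, 1) : Quad) ∈ sixList)
    intro h
    simpa using this (by simpa [add_comm] using h)
  refine hne (le_antisymm ?_ (by simpa [add_comm] using h1))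
  rcases n with _ | n
  · have he' := encodes_sixList' hd hab hbc hcd hbd had hac
    exact (he'.friendly hord hM).sixList'_le (he'.injOn hord) (x := (0, 2, 1, 1)) (by decide)
  · have he' := encodes_sevenList_of_adj (n := n) hd hab hbc hcd hbd hac
    have h2 : ord (mon4 a b c d 1 (3 + n) (1 + n) 1) ≤ ord (mon4 a b c d 0 (3 + n) (2 + n) 1) :=
      (he'.friendly hord hM).sevenList_le (he'.injOn hord) (x := (0, 3, 2, 1)) (by decide)
    rwa [add_comm 3, add_comm 2, add_comm 1] at h2

theorem encodes_star (hd : Distinct4 a b c d) (had : G.Adj a d) (hbd : G.Adj b d)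
    (hcd : G.Adj c d) (hab : ¬ G.Adj a b) (hac : ¬ G.Adj a c) (hbc : ¬ G.Adj b c) (hn : 0 < n)
    {L : List Quad} (B : Quad) (hB : below L B) (s t u : ℕ)
    (hL : ∀ x ∈ L, x.1 + s + (x.2.1 + t) + (x.2.2.1 + u) = n ∧ x.2.2.2 = 0)
    (hex : ∀ i j k, i + j + k = n → i ≤ B.1 + s → j ≤ B.2.1 + t → k ≤ B.2.2.1 + u →
      ∃ x ∈ L, x.1 + s = i ∧ x.2.1 + t = j ∧ x.2.2.1 + u = k) :
    Encodes (fun x => mon4 a b c d (x.1 + s) (x.2.1 + t) (x.2.2.1 + u) (x.2.2.2 + n)) L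
      (edgePowGens G n) := by
  refine encodes_mon4 hd hn B hB s t u n (fun x hx => ?_) ?_
  · obtain ⟨h, h'⟩ := hL x hx
    exact ⟨0, 0, x.1 + s, 0, x.2.1 + t, x.2.2.1 + u, by omega, by omega, by omega, by omega,
      by omega, .inl rfl, .inl rfl, .inr had, .inl rfl, .inr hbd, .inr hcd⟩
  · rintro i j k l ⟨ab, ac, ad, bc, bd, cd, h0, h1, h2, h3, h4, h5, h6, -, h8, -, -⟩ hi hj hk -
    have h5 := h5.resolve_right hab
    have h6 := h6.resolve_right hac
    have h8 := h8.resolve_right hbc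
    obtain ⟨x, hx, hx1, hx2, hx3⟩ := hex i j k (by omega) hi hj hk
    exact ⟨x, hx, hx1, hx2, hx3, by rw [(hL x hx).2]; omega⟩

/-- In a bridge-friendly order on a power of the ideal of a star, no monomial involving at least
two leaves can be the smallest one. -/
theorem false_of_star_min_of_le (hd : Distinct4 a b c d) (had : G.Adj a d) (hbd : G.Adj b d)
    (hcd : G.Adj c d) (hab : ¬ G.Adj a b) (hac : ¬ G.Adj a c) (hbc : ¬ G.Adj b c)
    (hord : Set.InjOn ord (edgePowGens G n)) (hM : BridgeFriendlyWrt (edgePowGens G n) ord)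
    {i j k : ℕ} (hn : i + j + k = n) (hk : 0 < k) (hkj : k ≤ j)
    (hmin : ∀ i' j' k', i' + j' + k' = n → 0 < j' ∧ 0 < k' ∨ 0 < i' ∧ 0 < k' ∨ 0 < i' ∧ 0 < j' →
      ord (mon4 a b c d i j k n) ≤ ord (mon4 a b c d i' j' k' n)) : False := by
  rcases Nat.lt_or_ge k 2 with hk2 | hk2
  · obtain rfl : k = 1 := by omega
    rcases Nat.lt_or_ge j 2 with hj2 | hj2
    · obtain rfl : j = 1 := by omega
      have he := encodes_star (n := n) hd had hbd hcd hab hac hbc (by omega) (L := smallTriangle)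
        (2, 1, 1, 0) (by decide) i 0 0
        (by simp only [smallTriangle, List.forall_mem_cons]; simp; omega)
        (by
          intro i' j' k' h hi hj hk
          dsimp only at hi hj hk
          obtain ⟨i', rfl⟩ := Nat.exists_eq_add_of_le' (show i ≤ i' by omega)
          simp only [add_le_add_iff_right] at hi hj hk
          interval_cases i' <;> interval_cases j' <;> interval_cases k' <;>
          first
          | omega
          | exact ⟨(_, _, _, 0), by decide, rfl, rfl, rfl⟩)
      obtain ⟨x, hx, hlt⟩ := (he.friendly hord hM).exists_lt_smallTriangle (he.injOn hord)
      revert hlt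
      simp only [zero_add, add_zero, not_lt, imp_false]
      simp only [List.mem_cons, List.not_mem_nil, or_false] at hx
      rcases hx with rfl | rfl <;> simp only [zero_add] <;>
        exact hmin _ _ _ (by omega) (by omega)
    · obtain ⟨j, rfl⟩ := Nat.exists_eq_add_of_le hj2
      have he := encodes_star (n := n) hd had hbd hcd hab hac hbc (by omega) (L := mediumTriangle)
        (2, 2, 1, 0) (by decide) i j 0
        (by simp only [mediumTriangle, List.forall_mem_cons]; simp; omega)
        (by
          intro i' j' k' h hi hj hk
          dsimp only at hi hj hk
          obtain ⟨i', rfl⟩ := Nat.exists_eq_add_of_le' (show i ≤ i' by omega)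
          obtain ⟨j', rfl⟩ := Nat.exists_eq_add_of_le' (show j ≤ j' by omega)
          simp only [add_le_add_iff_right] at hi hj hk
          interval_cases i' <;> interval_cases j' <;> interval_cases k' <;>
          first
          | omega
          | exact ⟨(_, _, _, 0), by decide, rfl, rfl, rfl⟩)
      obtain ⟨x, hx, hlt⟩ := (he.friendly hord hM).exists_lt_mediumTriangle (he.injOn hord)
      revert hlt
      simp only [zero_add, add_zero, not_lt, imp_false]
      simp only [mediumTriangle, List.mem_cons, List.not_mem_nil, or_false] at hx
      rcases hx with rfl | rfl | rfl | rfl | rfl <;> simp only [zero_add] <;>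
        exact hmin _ _ _ (by omega) (by omega)
  · obtain ⟨j, rfl⟩ := Nat.exists_eq_add_of_le (hk2.trans hkj)
    obtain ⟨k, rfl⟩ := Nat.exists_eq_add_of_le hk2
    have he := encodes_star (n := n) hd had hbd hcd hab hac hbc (by omega) (L := largeTriangle)
      (2, 2, 2, 0) (by decide) i j k
      (by simp only [largeTriangle, List.forall_mem_cons]; simp; omega)
      (by
        intro i' j' k' h hi hj hk
        dsimp only at hi hj hk
        obtain ⟨i', rfl⟩ := Nat.exists_eq_add_of_le' (show i ≤ i' by omega)
        obtain ⟨j', rfl⟩ := Nat.exists_eq_add_of_le' (show j ≤ j' by omega)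
        obtain ⟨k', rfl⟩ := Nat.exists_eq_add_of_le' (show k ≤ k' by omega)
        simp only [add_le_add_iff_right] at hi hj hk
        interval_cases i' <;> interval_cases j' <;> interval_cases k' <;>
        first
        | omega
        | exact ⟨(_, _, _, 0), by decide, rfl, rfl, rfl⟩)
    obtain ⟨x, hx, hlt⟩ := (he.friendly hord hM).exists_lt_largeTriangle (he.injOn hord)
    revert hlt
    simp only [zero_add, not_lt, imp_false]
    simp only [largeTriangle, List.mem_cons, List.not_mem_nil, or_false] at hx
    rcases hx with rfl | rfl | rfl | rfl | rfl | rfl <;> simp only [zero_add] <;>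
      exact hmin _ _ _ (by omega) (by omega)

theorem false_of_star_min (hd : Distinct4 a b c d) (had : G.Adj a d) (hbd : G.Adj b d)
    (hcd : G.Adj c d) (hab : ¬ G.Adj a b) (hac : ¬ G.Adj a c) (hbc : ¬ G.Adj b c)
    (hord : Set.InjOn ord (edgePowGens G n)) (hM : BridgeFriendlyWrt (edgePowGens G n) ord)
    {i j k : ℕ} (hn : i + j + k = n) (hj : 0 < j) (hk : 0 < k)
    (hmin : ∀ i' j' k', i' + j' + k' = n → 0 < j' ∧ 0 < k' ∨ 0 < i' ∧ 0 < k' ∨ 0 < i' ∧ 0 < j' →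
      ord (mon4 a b c d i j k n) ≤ ord (mon4 a b c d i' j' k' n)) : False := by
  rcases le_total k j with hkj | hkj
  · exact false_of_star_min_of_le hd had hbd hcd hab hac hbc hord hM hn hk hkj hmin
  · refine false_of_star_min_of_le hd.swap_middle had hcd hbd hac hab (fun h => hbc h.symm) hord
      hM (i := i) (j := k) (k := j) (by omega) hj hkj fun i' j' k' h h' => ?_
    rw [mon4_swap_middle hd.bc, mon4_swap_middle hd.bc]
    exact hmin _ _ _ (by omega) (by omega)

theorem not_bridgeFriendlyWrt_of_claw (hd : Distinct4 a b c d) (hn : 2 ≤ n) (had : G.Adj a d)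
    (hbd : G.Adj b d) (hcd : G.Adj c d) (hab : ¬ G.Adj a b) (hac : ¬ G.Adj a c)
    (hbc : ¬ G.Adj b c) (hord : Set.InjOn ord (edgePowGens G n)) :
    ¬ BridgeFriendlyWrt (edgePowGens G n) ord := by
  intro hM
  obtain ⟨⟨i, j, k⟩, ⟨h, hpos⟩, hmin⟩ := WellFounded.has_min
    (InvImage.wf (fun x : ℕ × ℕ × ℕ => ord (mon4 a b c d x.1 x.2.1 x.2.2 n)) wellFounded_lt)
    {x | x.1 + x.2.1 + x.2.2 = n ∧
      (0 < x.2.1 ∧ 0 < x.2.2 ∨ 0 < x.1 ∧ 0 < x.2.2 ∨ 0 < x.1 ∧ 0 < x.2.1)}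
    ⟨(1, n - 1, 0), by simp; omega⟩
  dsimp only at h hpos
  replace hmin : ∀ i' j' k', i' + j' + k' = n →
      0 < j' ∧ 0 < k' ∨ 0 < i' ∧ 0 < k' ∨ 0 < i' ∧ 0 < j' →
      ord (mon4 a b c d i j k n) ≤ ord (mon4 a b c d i' j' k' n) :=
    fun i' j' k' h1 h2 => not_lt.1 (hmin (i', j', k') ⟨h1, h2⟩)
  have hab' : ¬ G.Adj b a := fun h => hab h.symm
  have hac' : ¬ G.Adj c a := fun h => hac h.symm
  rcases hpos with ⟨hj, hk⟩ | ⟨hi, hk⟩ | ⟨hi, hj⟩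
  · exact false_of_star_min hd had hbd hcd hab hac hbc hord hM h hj hk hmin
  · refine false_of_star_min hd.swap_left hbd had hcd hab' hbc hac hord
      hM (i := j) (j := i) (k := k) (by omega) hi hk fun i' j' k' h h' => ?_
    rw [mon4_swap_left hd.ab, mon4_swap_left hd.ab]
    exact hmin _ _ _ (by omega) (by omega)
  · refine false_of_star_min hd.swap_middle.swap_left hcd had hbd hac'
      (fun h => hbc h.symm) hab hord hM (i := k) (j := i) (k := j) (by omega) hi hj
      fun i' j' k' h h' => ?_
    rw [mon4_swap_left hd.ac, mon4_swap_left hd.ac, mon4_swap_middle hd.bc,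
      mon4_swap_middle hd.bc]
    exact hmin _ _ _ (by omega) (by omega)

end Obstructions

section Triangle

variable {a b c : V}

/-- The vertices `a, b, c` are distinct and there are no others. -/
structure Vertices3 (a b c : V) : Prop where
  ab : a ≠ b
  ac : a ≠ c
  bc : b ≠ c
  eq : ∀ v, v = a ∨ v = b ∨ v = c

/-- The monomial `a ^ i * b ^ j * c ^ k` in the variables `a, b, c`. -/
def mon3 (a b : V) (i j k : ℕ) : V → ℕ := fun v => if v = a then i else if v = b then j else k

theorem mon3_ext (hV : Vertices3 a b c) {m : V → ℕ} {i j k : ℕ} :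
    m = mon3 a b i j k ↔ m a = i ∧ m b = j ∧ m c = k := by
  obtain ⟨hab, hac, hbc, heq⟩ := hV
  constructor
  · rintro rfl
    simp [mon3, hab.symm, hac.symm, hbc.symm]
  · rintro ⟨rfl, rfl, rfl⟩
    funext v
    unfold mon3
    rcases heq v with rfl | rfl | rfl <;> simp [hab.symm, hac.symm, hbc.symm]

variable [Fintype V] {G : SimpleGraph V} {n : ℕ} {ord : (V → ℕ) → ℕ}

theorem le_of_mem_edgePowGens {m : V → ℕ} (hm : m ∈ edgePowGens G n) (v : V) : m v ≤ n := by
  obtain ⟨l, rfl, -, rfl⟩ := mem_edgePowGens_iff.1 hm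
  clear hm
  induction l with
  | nil => simp
  | cons e l ih =>
    have : edgeMon e v ≤ 1 := by unfold edgeMon; split_ifs <;> omega
    simp only [List.map_cons, List.sum_cons, Pi.add_apply, List.length_cons]
    omega

theorem mem_edgePowGens_triangle (hV : Vertices3 a b c) (hab : G.Adj a b) (hac : G.Adj a c)
    (hbc : G.Adj b c) {m : V → ℕ} :
    m ∈ edgePowGens G n ↔ m a + m b + m c = 2 * n ∧ m a ≤ n ∧ m b ≤ n ∧ m c ≤ n := by
  constructor
  · intro hm
    refine ⟨?_, le_of_mem_edgePowGens hm a, le_of_mem_edgePowGens hm b,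
      le_of_mem_edgePowGens hm c⟩
    rw [← sum_edgePowGens hm, show (Finset.univ : Finset V) = {a, b, c} from
      Finset.ext fun v => by simpa using hV.eq v,
      Finset.sum_insert (by simp [hV.ab, hV.ac]), Finset.sum_pair hV.bc, add_assoc]
  · rintro ⟨h, ha, hb, hc⟩
    have := add_mem_edgePowGens (add_mem_edgePowGens (smul_edgeMon_mem (k := n - m c) (.inr hab))
      (smul_edgeMon_mem (k := n - m b) (.inr hac))) (smul_edgeMon_mem (k := n - m a) (.inr hbc))
    rw [show n - m c + (n - m b) + (n - m a) = n by omega] at this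
    convert this
    funext v
    rcases hV.eq v with rfl | rfl | rfl <;>
      simp [edgeMon, hV.ab, hV.ac, hV.bc, hV.ab.symm, hV.ac.symm, hV.bc.symm] <;> omega

theorem encodes_triangle (hV : Vertices3 a b c) (hab : G.Adj a b) (hac : G.Adj a c)
    (hbc : G.Adj b c) (hn : 0 < n) {L : List Quad} (B : Quad) (hB : below L B) (s t u : ℕ)
    (hL : ∀ x ∈ L, x.1 + s + (x.2.1 + t) + (x.2.2.1 + u) = 2 * n ∧ x.1 + s ≤ n ∧ x.2.1 + t ≤ n ∧
      x.2.2.1 + u ≤ n ∧ x.2.2.2 = 0)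
    (hex : ∀ i j k, i + j + k = 2 * n → i ≤ n → j ≤ n → k ≤ n → i ≤ B.1 + s → j ≤ B.2.1 + t →
      k ≤ B.2.2.1 + u → ∃ x ∈ L, x.1 + s = i ∧ x.2.1 + t = j ∧ x.2.2.1 + u = k) :
    Encodes (fun x => mon3 a b (x.1 + s) (x.2.1 + t) (x.2.2.1 + u)) L (edgePowGens G n) := by
  have hval : ∀ i j k, mon3 a b i j k a = i ∧ mon3 a b i j k b = j ∧ mon3 a b i j k c = k :=
    fun i j k => (mon3_ext hV).1 rfl
  have hmem : ∀ x ∈ L, mon3 a b (x.1 + s) (x.2.1 + t) (x.2.2.1 + u) ∈ edgePowGens G n := by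
    intro x hx
    rw [mem_edgePowGens_triangle hV hab hac hbc, (hval _ _ _).1, (hval _ _ _).2.1,
      (hval _ _ _).2.2]
    have := hL x hx
    tauto
  refine ⟨hmem, ?_, fun m hm hle => ?_, fun S hS x hx => ?_⟩
  · rintro ⟨x1, x2, x3, x4⟩ hx ⟨y1, y2, y3, y4⟩ hy he
    obtain ⟨h1, h2, h3⟩ := (mon3_ext hV).1 he
    obtain ⟨h1', h2', h3'⟩ := hval (x1 + s) (x2 + t) (x3 + u)
    have hx4 := (hL _ hx).2.2.2.2
    have hy4 := (hL _ hy).2.2.2.2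
    dsimp only at h1 h2 h3 hx4 hy4
    simp only [Prod.mk.injEq]
    omega
  · simp only [below, List.all_eq_true, Bool.and_eq_true, Nat.ble_eq] at hB
    rw [le_mlcm_iff] at hle
    simp only [mem_encoded] at hle
    obtain ⟨h, ha, hb, hc⟩ := (mem_edgePowGens_triangle hV hab hac hbc).1 hm
    obtain ⟨x, hx, h1, h2, h3⟩ := hex (m a) (m b) (m c) h ha hb hc
      (by
        rcases hle a with h | ⟨_, ⟨x, hx, rfl⟩, h⟩
        · omega
        · rw [(hval _ _ _).1] at h; have := hB x hx; omega)
      (by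
        rcases hle b with h | ⟨_, ⟨x, hx, rfl⟩, h⟩
        · omega
        · rw [(hval _ _ _).2.1] at h; have := hB x hx; omega)
      (by
        rcases hle c with h | ⟨_, ⟨x, hx, rfl⟩, h⟩
        · omega
        · rw [(hval _ _ _).2.2] at h; have := hB x hx; omega)
    exact ⟨x, hx, ((mon3_ext hV).2 ⟨h1.symm, h2.symm, h3.symm⟩).symm⟩
  · have h0 : mon3 a b (x.1 + s) (x.2.1 + t) (x.2.2.1 + u) ≠ 0 :=
      fun h => zero_notMem_edgePowGens hn (h ▸ hmem x hx)
    rw [le_mlcm_encoded_iff (φ := fun x : Quad => mon3 a b (x.1 + s) (x.2.1 + t)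
      (x.2.2.1 + u)) h0, covers_iff_exists]
    constructor
    · rintro ⟨⟨y, hy, h1⟩, ⟨y2, hy2, h2⟩, ⟨y3, hy3, h3⟩, -⟩
      refine ⟨List.ne_nil_of_mem hy, fun v => ?_⟩
      rcases hV.eq v with rfl | rfl | rfl
      · exact ⟨y, hy, by simpa only [(hval _ _ _).1, Nat.add_le_add_iff_right]⟩
      · exact ⟨y2, hy2, by simpa only [(hval _ _ _).2.1, Nat.add_le_add_iff_right]⟩
      · exact ⟨y3, hy3, by simpa only [(hval _ _ _).2.2, Nat.add_le_add_iff_right]⟩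
    · rintro ⟨hS', h⟩
      have ha := h a
      have hb := h b
      have hc := h c
      simp only [(hval _ _ _).1, (hval _ _ _).2.1, (hval _ _ _).2.2,
        Nat.add_le_add_iff_right] at ha hb hc
      obtain ⟨y, hy⟩ := List.exists_mem_of_ne_nil S hS'
      exact ⟨ha, hb, hc, y, hy, by simp [(hL x hx).2.2.2.2]⟩

/-- In a bridge-friendly order on a large power of the ideal of a triangle, the exponents of the
smallest monomial cannot be small. -/
theorem lt_of_triangle_min (hV : Vertices3 a b c) (hab : G.Adj a b) (hac : G.Adj a c)
    (hbc : G.Adj b c) (hord : Set.InjOn ord (edgePowGens G n))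
    (hM : BridgeFriendlyWrt (edgePowGens G n) ord) {m : V → ℕ} (hm : m ∈ edgePowGens G n)
    (hmin : ∀ m' ∈ edgePowGens G n, ord m ≤ ord m') : n < m a + 2 := by
  by_contra! hle
  obtain ⟨h, ha, hb, hc⟩ := (mem_edgePowGens_triangle hV hab hac hbc).1 hm
  obtain ⟨j, hj⟩ := Nat.exists_eq_add_of_le' (show 2 ≤ m b by omega)
  obtain ⟨k, hk⟩ := Nat.exists_eq_add_of_le' (show 2 ≤ m c by omega)
  have he := encodes_triangle (n := n) hV hab hac hbc (by omega) (L := largeTriangle) (2, 2, 2, 0)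
    (by decide) (m a) j k
    (by simp only [largeTriangle, List.forall_mem_cons]; simp; omega)
    (by
      rintro i' j' k' h - - - hi hj hk
      dsimp only at hi hj hk
      obtain ⟨i', rfl⟩ := Nat.exists_eq_add_of_le' (show m a ≤ i' by omega)
      obtain ⟨j', rfl⟩ := Nat.exists_eq_add_of_le' (show j ≤ j' by omega)
      obtain ⟨k', rfl⟩ := Nat.exists_eq_add_of_le' (show k ≤ k' by omega)
      simp only [add_le_add_iff_right] at hi hj hk
      interval_cases i' <;> interval_cases j' <;> interval_cases k' <;>
      first
      | omega
      | exact ⟨(_, _, _, 0), by decide, rfl, rfl, rfl⟩)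
  obtain ⟨x, hx, hlt⟩ := (he.friendly hord hM).exists_lt_largeTriangle (he.injOn hord)
  refine absurd (hmin _ (he.mem x hx)) (not_le.2 ?_)
  have hm' : m = mon3 a b (0 + m a) (2 + j) (2 + k) :=
    (mon3_ext hV).2 ⟨(zero_add _).symm, hj.trans (add_comm _ _), hk.trans (add_comm _ _)⟩
  exact hlt.trans_eq (congrArg ord hm'.symm)

theorem not_bridgeFriendlyWrt_of_triangle (hV : Vertices3 a b c) (hab : G.Adj a b)
    (hac : G.Adj a c) (hbc : G.Adj b c) (hn : 4 ≤ n) (hord : Set.InjOn ord (edgePowGens G n)) :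
    ¬ BridgeFriendlyWrt (edgePowGens G n) ord := by
  intro hM
  obtain ⟨m, hm, hmin⟩ := (edgePowGens G n).exists_min_image ord
    ⟨_, smul_edgeMon_mem (k := n) (.inr hab)⟩
  have ha := lt_of_triangle_min hV hab hac hbc hord hM hm hmin
  have hb := lt_of_triangle_min (a := b) (b := a) (c := c)
    ⟨hV.ab.symm, hV.bc, hV.ac, fun v => by have := hV.eq v; tauto⟩ hab.symm hbc hac hord hM hm hmin
  have hc := lt_of_triangle_min (a := c) (b := a) (c := b)
    ⟨hV.ac.symm, hV.bc.symm, hV.ab, fun v => by have := hV.eq v; tauto⟩ hac.symm hbc.symm hab hord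
    hM hm hmin
  have := ((mem_edgePowGens_triangle hV hab hac hbc).1 hm).1
  omega

end Triangle

section Classification

variable {G : SimpleGraph V} {a b c d : V} {n : ℕ}

/-- A vertex set of a connected graph which is closed under adjacency contains every vertex. -/
theorem forall_of_adj_closed (hG : G.Connected) {p : V → Prop} (ha : p a)
    (hp : ∀ u v, G.Adj u v → p u → p v) (v : V) : p v := by
  obtain ⟨w⟩ := hG.preconnected a v
  induction w with
  | nil => exact ha
  | cons h _ ih => exact ih (hp _ _ h ha)

theorem Vertices3.exists_equiv (hV : Vertices3 a b c) :
    ∃ e : Fin 3 ≃ V, e 0 = a ∧ e 1 = b ∧ e 2 = c := by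
  obtain ⟨hab, hac, hbc, heq⟩ := hV
  refine ⟨Equiv.ofBijective ![a, b, c] ⟨?_, fun v => ?_⟩, rfl, rfl, rfl⟩
  · intro i j
    fin_cases i <;> fin_cases j <;> simp [hab, hac, hbc, hab.symm, hac.symm, hbc.symm]
  · rcases heq v with rfl | rfl | rfl
    exacts [⟨0, rfl⟩, ⟨1, rfl⟩, ⟨2, rfl⟩]

theorem vertices3_symm_apply (e : V ≃ Fin 3) : Vertices3 (e.symm 0) (e.symm 1) (e.symm 2) := by
  refine ⟨by simp, by simp, by simp, fun v => ?_⟩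
  simp only [Equiv.eq_symm_apply]
  generalize e v = i
  fin_cases i <;> simp

theorem nonempty_iso_pathGraph_two (hab : G.Adj a b) (hV : ∀ v, v = a ∨ v = b) :
    Nonempty (G ≃g SimpleGraph.pathGraph 2) := by
  have e : Function.Bijective (![a, b] : Fin 2 → V) := by
    refine ⟨fun i j => ?_, fun v => ?_⟩
    · fin_cases i <;> fin_cases j <;> simp [hab.ne, hab.ne.symm]
    · rcases hV v with rfl | rfl
      exacts [⟨0, rfl⟩, ⟨1, rfl⟩]
  refine ⟨SimpleGraph.Iso.symm ⟨Equiv.ofBijective _ e, fun {i j} => ?_⟩⟩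
  fin_cases i <;> fin_cases j <;> simp [SimpleGraph.pathGraph_adj, hab, hab.symm]

theorem nonempty_iso_pathGraph_three (hV : Vertices3 a b c) (hab : G.Adj a b) (hbc : G.Adj b c)
    (hac : ¬ G.Adj a c) : Nonempty (G ≃g SimpleGraph.pathGraph 3) := by
  obtain ⟨e, rfl, rfl, rfl⟩ := hV.exists_equiv
  refine ⟨SimpleGraph.Iso.symm ⟨e, fun {i j} => ?_⟩⟩
  have hca : ¬ G.Adj (e 2) (e 0) := fun h => hac h.symm
  fin_cases i <;> fin_cases j <;>
    simp [SimpleGraph.pathGraph_adj, hab, hab.symm, hbc, hbc.symm, hac, hca]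

theorem nonempty_iso_cycleGraph_three (hV : Vertices3 a b c) (hab : G.Adj a b) (hbc : G.Adj b c)
    (hac : G.Adj a c) : Nonempty (G ≃g SimpleGraph.cycleGraph 3) := by
  obtain ⟨e, rfl, rfl, rfl⟩ := hV.exists_equiv
  rw [SimpleGraph.cycleGraph_three_eq_top]
  refine ⟨SimpleGraph.Iso.symm ⟨e, fun {i j} => ?_⟩⟩
  fin_cases i <;> fin_cases j <;> simp [hab, hab.symm, hbc, hbc.symm, hac, hac.symm]

variable [Fintype V] {ord : (V → ℕ) → ℕ}

theorem not_bridgeFriendlyWrt_of_path (hd : Distinct4 a b c d) (hn : 2 ≤ n) (hab : G.Adj a b)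
    (hbc : G.Adj b c) (hcd : G.Adj c d) (hord : Set.InjOn ord (edgePowGens G n)) :
    ¬ BridgeFriendlyWrt (edgePowGens G n) ord := by
  by_cases hac : G.Adj a c <;> by_cases hbd : G.Adj b d
  · exact not_bridgeFriendlyWrt_of_complete hd hn hab hbc hcd hac hbd hord
  · have hd' : Distinct4 d c b a :=
      ⟨hd.cd.symm, hd.bd.symm, hd.ad.symm, hd.bc.symm, hd.ac.symm, hd.ab.symm⟩
    have hdb : ¬ G.Adj d b := fun h => hbd h.symm
    by_cases hda : G.Adj d a
    · exact not_bridgeFriendlyWrt_of_diamond hd' hn hcd.symm hbc.symm hab.symm hac.symm hda hdb hord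
    · exact not_bridgeFriendlyWrt_of_paw hd' hn hcd.symm hbc.symm hab.symm hac.symm hdb hda hord
  · by_cases had : G.Adj a d
    · exact not_bridgeFriendlyWrt_of_diamond hd hn hab hbc hcd hbd had hac hord
    · exact not_bridgeFriendlyWrt_of_paw hd hn hab hbc hcd hbd hac had hord
  · exact not_bridgeFriendlyWrt_of_rhombus hd hn hab hbc hcd hac hbd hord

theorem not_bridgeFriendlyWrt_of_degree (hd : Distinct4 a b c d) (hn : 2 ≤ n) (had : G.Adj a d)
    (hbd : G.Adj b d) (hcd : G.Adj c d) (hord : Set.InjOn ord (edgePowGens G n)) :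
    ¬ BridgeFriendlyWrt (edgePowGens G n) ord := by
  obtain ⟨dab, dac, dad, dbc, dbd, dcd⟩ := hd
  by_cases hab : G.Adj a b
  · exact not_bridgeFriendlyWrt_of_path ⟨dcd, dac.symm, dbc.symm, dad.symm, dbd.symm, dab⟩ hn hcd
      had.symm hab hord
  by_cases hac : G.Adj a c
  · exact not_bridgeFriendlyWrt_of_path ⟨dbd, dab.symm, dbc, dad.symm, dcd.symm, dac⟩ hn hbd
      had.symm hac hord
  by_cases hbc : G.Adj b c
  · exact not_bridgeFriendlyWrt_of_path ⟨dad, dab, dac, dbd.symm, dcd.symm, dbc⟩ hn had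
      hbd.symm hbc hord
  exact not_bridgeFriendlyWrt_of_claw ⟨dab, dac, dad, dbc, dbd, dcd⟩ hn had hbd hcd hab hac hbc hord

/-- A connected graph with a bridge-friendly power has no vertices outside a path of length
two. -/
theorem vertices3_of_bridgeFriendly (hG : G.Connected) (hn : 2 ≤ n)
    (hM : BridgeFriendly (edgePowGens G n)) (hab : G.Adj a b) (hbc : G.Adj b c) (hac : a ≠ c) :
    Vertices3 a b c := by
  obtain ⟨ord, hord, hM⟩ := hM
  refine ⟨hab.ne, hac, hbc.ne, forall_of_adj_closed hG (.inl rfl) fun u v huv hu => ?_⟩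
  by_contra! hv
  obtain ⟨hva, hvb, hvc⟩ := hv
  rcases hu with rfl | rfl | rfl
  · exact not_bridgeFriendlyWrt_of_path ⟨hva, hvb, hvc, hab.ne, hac, hbc.ne⟩ hn huv.symm hab hbc
      hord hM
  · exact not_bridgeFriendlyWrt_of_degree ⟨hac, hva.symm, hab.ne, hvc.symm, hbc.ne.symm, hvb⟩ hn
      hab hbc.symm huv.symm hord hM
  · exact not_bridgeFriendlyWrt_of_path ⟨hab.ne, hac, hva.symm, hbc.ne, hvb.symm, hvc.symm⟩ hn
      hab hbc huv hord hM

theorem classification_of_bridgeFriendly (hG : G.Connected) (hedge : G.edgeSet.Nonempty)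
    (hn : 2 ≤ n) (hM : BridgeFriendly (edgePowGens G n)) :
    Nonempty (G ≃g SimpleGraph.pathGraph 2) ∨ Nonempty (G ≃g SimpleGraph.pathGraph 3) ∨
      ((n = 2 ∨ n = 3) ∧ Nonempty (G ≃g SimpleGraph.cycleGraph 3)) := by
  have key : ∀ a b c : V, G.Adj a b → G.Adj b c → a ≠ c →
      Nonempty (G ≃g SimpleGraph.pathGraph 3) ∨
        ((n = 2 ∨ n = 3) ∧ Nonempty (G ≃g SimpleGraph.cycleGraph 3)) := by
    intro a b c hab hbc hne
    have hV := vertices3_of_bridgeFriendly hG hn hM hab hbc hne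
    by_cases hac : G.Adj a c
    · refine .inr ⟨?_, nonempty_iso_cycleGraph_three hV hab hbc hac⟩
      obtain ⟨ord, hord, hM⟩ := hM
      by_contra! h
      exact not_bridgeFriendlyWrt_of_triangle hV hab hac hbc (by omega) hord hM
    · exact .inl (nonempty_iso_pathGraph_three hV hab hbc hac)
  obtain ⟨e, he⟩ := hedge
  induction e with | h a b => ?_
  have hab : G.Adj a b := he
  by_cases hV : ∀ v, v = a ∨ v = b
  · exact .inl (nonempty_iso_pathGraph_two hab hV)
  · refine .inr ?_
    by_contra hcon
    refine hV (forall_of_adj_closed hG (.inl rfl) fun u v huv hu => ?_)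
    by_contra! hv
    rcases hu with rfl | rfl
    · exact hcon (key b u v hab.symm huv hv.2.symm)
    · exact hcon (key a u v hab huv hv.1.symm)

end Classification

section BridgeFriendly

variable {G : SimpleGraph V} {a b c : V} {n : ℕ}

theorem bridgeFriendly_of_subsingleton {M : Finset (V → ℕ)}
    (hM : ∀ m ∈ M, ∀ m' ∈ M, m = m') : BridgeFriendly M := by
  have hord : Set.InjOn (fun _ => 0) (M : Set (V → ℕ)) := fun m hm m' hm' _ => hM m hm m' hm'
  exact ⟨_, hord, (bridgeFriendlyWrt_iff hord).2 fun _ _ q hq r hr _ _ _ _ => hM q hq r hr⟩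

/-- A set of monomials in the variables `a, b, c` in which the exponent of `b` is constant and
those of `a`, `c` have constant sum is bridge-friendly. -/
theorem bridgeFriendly_of_vertices3 (hV : Vertices3 a b c) {M : Finset (V → ℕ)}
    (hM : ∀ m ∈ M, m b = n ∧ m a + m c = n) : BridgeFriendly M := by
  have hord : Set.InjOn (fun m => m a) (M : Set (V → ℕ)) := by
    intro m hm m' hm' (h : m a = m' a)
    have := hM m hm
    have := hM m' hm'
    funext v
    rcases hV.eq v with rfl | rfl | rfl <;> omega
  refine ⟨_, hord, (bridgeFriendlyWrt_iff hord).2 fun τ hτ => ?_⟩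
  have key : ∀ q ∈ M, ∀ r ∈ M, q ∉ τ →
      IsPivot M (fun m => m a) τ q →
      IsPivot M (fun m => m a) τ r → r a ≤ q a := by
    intro q hq r hr hqτ hpq hpr
    by_contra! hlt
    obtain hrq | ⟨m, hm, hmq, hle, hnot⟩ := hpr.2.2 q hq
      (by simpa [hqτ] using fun h : q = r => hlt.ne (congrFun h a)) hpq.1
    · dsimp only at hrq
      omega
    dsimp only at hmq
    have hmτ : m ∈ τ := (Finset.mem_insert.1 hm).resolve_left (by rintro rfl; omega)
    have hmb := hM m (hτ hmτ)
    have hqb := hM q hq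
    obtain hq0 | ⟨g, hg, hqg⟩ := le_mlcm_iff.1 hpq.1 a
    · omega
    have hge : g ∈ (insert r τ).erase m :=
      Finset.mem_erase.2 ⟨by rintro rfl; omega, Finset.mem_insert_of_mem hg⟩
    refine hnot (le_mlcm_iff.2 fun v => ?_)
    rcases hV.eq v with rfl | rfl | rfl
    · exact .inr ⟨g, hge, by omega⟩
    · exact .inr ⟨g, hge, by rw [hmb.1, (hM g (hτ hg)).1]⟩
    · refine (le_mlcm_iff.1 hle v).imp_right ?_
      rintro ⟨g', hg', h⟩
      obtain rfl | hg' := Finset.mem_insert.1 hg'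
      · omega
      · exact ⟨g', hg', h⟩
  exact fun q hq r hr hqτ hrτ hpq hpr =>
    hord hq hr (le_antisymm (key r hr q hq hrτ hpr hpq) (key q hq r hr hqτ hpq hpr))

/-- Every sublist of `L` has at most one pivot. -/
def uniquePivots (L : List Quad) (lt : Quad → Quad → Bool) : Bool :=
  L.sublists.all fun τ => Nat.ble (L.filter fun q => !τ.contains q && pivotB L lt τ q).length 1

theorem Encodes.bridgeFriendlyWrt {φ : Quad → V → ℕ} {L : List Quad} {M : Finset (V → ℕ)}
    (h : Encodes φ L M) (hL : M ⊆ encoded φ L) {ord : (V → ℕ) → ℕ} (hord : Set.InjOn ord M)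
    (hu : uniquePivots L fun x y => ord (φ x) < ord (φ y)) : BridgeFriendlyWrt M ord := by
  rw [bridgeFriendlyWrt_iff hord]
  intro τ hτ q hq r hr hqτ hrτ hpq hpr
  obtain ⟨x, hx, rfl⟩ := mem_encoded.1 (hL hq)
  obtain ⟨y, hy, rfl⟩ := mem_encoded.1 (hL hr)
  obtain ⟨S, hS, rfl⟩ : ∃ S, S.Sublist L ∧ τ = encoded φ S := by
    refine ⟨L.filter fun x => φ x ∈ τ, List.filter_sublist, Finset.ext fun m => ?_⟩
    rw [mem_encoded]
    constructor
    · intro hm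
      obtain ⟨z, hz, rfl⟩ := mem_encoded.1 (hL (hτ hm))
      exact ⟨z, by simp [hz, hm], rfl⟩
    · rintro ⟨z, hz, rfl⟩
      simpa using (List.mem_filter.1 hz).2
  rw [h.mem_encoded_iff hS.subset hx] at hqτ
  rw [h.mem_encoded_iff hS.subset hy] at hrτ
  rw [h.isPivot_iff ord hS.subset hx] at hpq
  rw [h.isPivot_iff ord hS.subset hy] at hpr
  have hcard := List.all_eq_true.1 hu S (List.mem_sublists.2 hS)
  rw [Nat.ble_eq] at hcard
  have hmem : ∀ z ∈ L, z ∉ S → pivotB L (fun x y => ord (φ x) < ord (φ y)) S z →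
      z ∈ L.filter fun q => !S.contains q && pivotB L (fun x y => ord (φ x) < ord (φ y)) S q := by
    intro z hz hzS hp
    simp [hz, hzS, hp]
  have hx' := hmem x hx hqτ hpq
  have hy' := hmem y hy hrτ hpr
  generalize L.filter _ = F at hx' hy' hcard
  obtain _ | ⟨z, _ | ⟨w, F⟩⟩ := F
  · simp at hx'
  · rw [List.mem_singleton.1 hx', List.mem_singleton.1 hy']
  · simp at hcard

variable [Fintype V]

theorem apply_eq_of_mem_edgePowGens {m : V → ℕ} (hm : m ∈ edgePowGens G n)
    (hb : ∀ e ∈ G.edgeSet, b ∈ e) : m b = n := by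
  obtain ⟨l, rfl, hl, rfl⟩ := mem_edgePowGens_iff.1 hm
  clear hm
  induction l with
  | nil => simp
  | cons e l ih =>
    rw [List.forall_mem_cons] at hl
    simp only [List.map_cons, List.sum_cons, Pi.add_apply, List.length_cons, ih hl.2, edgeMon,
      if_pos (hb e hl.1)]
    omega

theorem bridgeFriendly_of_pathGraph_two (e : G ≃g SimpleGraph.pathGraph 2) :
    BridgeFriendly (edgePowGens G n) := by
  have he : ∀ x ∈ G.edgeSet, ∀ v, v ∈ x := by
    intro x hx v
    induction x with | h a b => ?_
    have hab : e a ≠ e b := e.injective.ne (G.ne_of_adj hx)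
    rw [Sym2.mem_iff, ← e.injective.eq_iff, ← e.injective.eq_iff (b := b)]
    omega
  exact bridgeFriendly_of_subsingleton fun m hm m' hm' => funext fun v =>
    (apply_eq_of_mem_edgePowGens hm fun x hx => he x hx v).trans
      (apply_eq_of_mem_edgePowGens hm' fun x hx => he x hx v).symm

theorem bridgeFriendly_of_pathGraph_three (e : G ≃g SimpleGraph.pathGraph 3) :
    BridgeFriendly (edgePowGens G n) := by
  have hV := vertices3_symm_apply e.toEquiv
  refine bridgeFriendly_of_vertices3 (n := n) hV fun m hm => ?_
  have h1 := apply_eq_of_mem_edgePowGens (b := e.symm 1) hm fun x hx => by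
    induction x with | h u v => ?_
    have huv : (SimpleGraph.pathGraph 3).Adj (e u) (e v) := e.map_adj_iff.2 hx
    rw [SimpleGraph.pathGraph_adj] at huv
    rw [Sym2.mem_iff, ← e.injective.eq_iff, ← e.injective.eq_iff (b := v), e.apply_symm_apply]
    omega
  have h2 := sum_edgePowGens hm
  rw [← e.symm.toEquiv.sum_comp, Fin.sum_univ_three] at h2
  change m (e.symm 0) + m (e.symm 1) + m (e.symm 2) = _ at h2
  change m (e.symm 1) = n ∧ m (e.symm 0) + m (e.symm 2) = n
  omega

end BridgeFriendly

section SmallTriangles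

/-- The position in the list `L` of the elements with the first two entries `i` and `j`, where
the second entries are less than four. -/
def position (L : List Quad) (i j : ℕ) : ℕ := (L.map fun x => 4 * x.1 + x.2.1).idxOf (4 * i + j)

/-- The generators of the square of the edge ideal of a triangle. -/
def triangleSquare : List Quad :=
  [(1, 1, 2, 0), (1, 2, 1, 0), (2, 1, 1, 0), (0, 2, 2, 0), (2, 0, 2, 0), (2, 2, 0, 0)]

/-- The generators of the cube of the edge ideal of a triangle. -/
def triangleCube : List Quad :=
  [(2, 2, 2, 0), (2, 3, 1, 0), (3, 2, 1, 0), (3, 1, 2, 0), (1, 3, 2, 0), (2, 1, 3, 0),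
    (1, 2, 3, 0), (3, 3, 0, 0), (3, 0, 3, 0), (0, 3, 3, 0)]

theorem mem_triangleSquare : ∀ i ≤ 2, ∀ j ≤ 2, ∀ k ≤ 2, i + j + k = 2 * 2 →
    (i, j, k, 0) ∈ triangleSquare := by
  intro i hi j hj k hk h
  interval_cases i <;> interval_cases j <;> interval_cases k <;> first | omega | decide

theorem mem_triangleCube : ∀ i ≤ 3, ∀ j ≤ 3, ∀ k ≤ 3, i + j + k = 2 * 3 →
    (i, j, k, 0) ∈ triangleCube := by
  intro i hi j hj k hk h
  interval_cases i <;> interval_cases j <;> interval_cases k <;> first | omega | decide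

theorem uniquePivots_triangleSquare : uniquePivots triangleSquare fun x y =>
    position triangleSquare x.1 x.2.1 < position triangleSquare y.1 y.2.1 := by
  decide +kernel

theorem uniquePivots_triangleCube : uniquePivots triangleCube fun x y =>
    position triangleCube x.1 x.2.1 < position triangleCube y.1 y.2.1 := by
  decide +kernel

variable [Fintype V] {G : SimpleGraph V} {a b c : V} {n : ℕ}

theorem bridgeFriendly_of_uniquePivots (hV : Vertices3 a b c) (hab : G.Adj a b) (hac : G.Adj a c)
    (hbc : G.Adj b c) (h0 : 0 < n) (h3 : n ≤ 3) {L : List Quad}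
    (hL : ∀ x ∈ L, x.1 + (x.2.1 + x.2.2.1) = 2 * n ∧ x.1 ≤ n ∧ x.2.1 ≤ n ∧ x.2.2.1 ≤ n ∧
      x.2.2.2 = 0)
    (hmem : ∀ i ≤ n, ∀ j ≤ n, ∀ k ≤ n, i + j + k = 2 * n → (i, j, k, 0) ∈ L)
    (hu : uniquePivots L fun x y => position L x.1 x.2.1 < position L y.1 y.2.1) :
    BridgeFriendly (edgePowGens G n) := by
  have hmon : ∀ i j k, mon3 a b i j k a = i ∧ mon3 a b i j k b = j :=
    fun i j k => ⟨((mon3_ext hV).1 rfl).1, ((mon3_ext hV).1 rfl).2.1⟩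
  have henc := encodes_triangle (L := L) hV hab hac hbc h0 (n, n, n, 0)
    (by
      simp only [below, List.all_eq_true, Bool.and_eq_true, Nat.ble_eq]
      intro x hx
      have := hL x hx
      omega) 0 0 0
    (fun x hx => by have := hL x hx; omega)
    fun i j k h hi hj hk _ _ _ => ⟨_, hmem i hi j hj k hk h, rfl, rfl, rfl⟩
  have hsub : ∀ m ∈ edgePowGens G n, (m a, m b, m c, 0) ∈ L := fun m hm => by
    obtain ⟨h, ha, hb, hc⟩ := (mem_edgePowGens_triangle hV hab hac hbc).1 hm
    exact hmem _ ha _ hb _ hc h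
  have hord : Set.InjOn (fun m : V → ℕ => position L (m a) (m b)) (edgePowGens G n) := by
    intro m hm m' hm' h
    have h := (List.idxOf_inj (List.mem_map_of_mem (f := fun x : Quad => 4 * x.1 + x.2.1)
      (hsub m hm))).1 h
    obtain ⟨h1, ha, hb, -⟩ := (mem_edgePowGens_triangle hV hab hac hbc).1 hm
    obtain ⟨h1', ha', hb', -⟩ := (mem_edgePowGens_triangle hV hab hac hbc).1 hm'
    dsimp only at h
    funext v
    rcases hV.eq v with rfl | rfl | rfl <;> omega
  refine ⟨_, hord, henc.bridgeFriendlyWrt (fun m hm => ?_) hord ?_⟩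
  · exact mem_encoded.2 ⟨_, hsub m hm, ((mon3_ext hV).2 ⟨rfl, rfl, rfl⟩).symm⟩
  · simpa only [(hmon _ _ _).1, (hmon _ _ _).2, add_zero] using hu

theorem bridgeFriendly_of_cycleGraph_three (hn : n = 2 ∨ n = 3)
    (e : G ≃g SimpleGraph.cycleGraph 3) : BridgeFriendly (edgePowGens G n) := by
  have hadj : ∀ i j : Fin 3, i ≠ j → G.Adj (e.symm i) (e.symm j) := fun i j hij => by
    rw [e.symm.map_adj_iff, SimpleGraph.cycleGraph_three_eq_top]
    exact hij
  have h01 := hadj 0 1 (by decide)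
  have h02 := hadj 0 2 (by decide)
  have h12 := hadj 1 2 (by decide)
  have hV := vertices3_symm_apply e.toEquiv
  obtain rfl | rfl := hn
  · exact bridgeFriendly_of_uniquePivots hV h01 h02 h12 (by omega) (by omega) (by decide)
      mem_triangleSquare uniquePivots_triangleSquare
  · exact bridgeFriendly_of_uniquePivots hV h01 h02 h12 (by omega) (by omega) (by decide)
      mem_triangleCube uniquePivots_triangleCube

end SmallTriangles

/-- **Theorem 4.15.** For a finite connected simple graph `G` with at least one edge and
`n ≥ 2`, the ideal `I(G)^n` is bridge-friendly iff `G` is a single edge, or a path of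
length 2, or `n ∈ {2,3}` and `G` is the triangle `C₃`. -/
theorem edgeIdealPow_bridgeFriendly_iff {V : Type} [Fintype V] (G : SimpleGraph V)
    (hconn : G.Connected) (hedge : G.edgeSet.Nonempty) (n : ℕ) (hn : 2 ≤ n) :
    BridgeFriendly (edgePowGens G n) ↔
      Nonempty (G ≃g SimpleGraph.pathGraph 2) ∨
      Nonempty (G ≃g SimpleGraph.pathGraph 3) ∨
      ((n = 2 ∨ n = 3) ∧ Nonempty (G ≃g SimpleGraph.cycleGraph 3)) := by
  refine ⟨classification_of_bridgeFriendly hconn hedge hn, ?_⟩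
  rintro (⟨⟨e⟩⟩ | ⟨⟨e⟩⟩ | ⟨h, ⟨e⟩⟩)
  · exact bridgeFriendly_of_pathGraph_two e
  · exact bridgeFriendly_of_pathGraph_three e
  · exact bridgeFriendly_of_cycleGraph_three h e

end ChauHaMaithani
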